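/- Maximum bisection of sparse Erdős–Rényi graphs: for every ε > 0 there exists γ₀ < ∞ such that for every γ ≥ γ₀, if G ~ G(n, ⌊γn⌋) is a uniformly random simple graph on n vertices with ⌊γn⌋ edges, then P( |MCUT(G)/n − (γ/2 + P_*·√(γ/2))| ≤ ε·√γ ) → 1 as n → ∞. (That is, w.h.p. MCUT(G)/n = γ/2 + P_*√(γ/2) + o_γ(√γ).) -/

import Mathlib

open MeasureTheory Filter Finset

/-- The real value (±1) of a Boolean spin. -/
noncomputable def spin (b : Bool) : ℝ := if b then 1 else -1

/-- The Sherrington–Kirkpatrick Hamiltonian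
`H^SK_n(σ) = -(2n)^{-1/2} Σ_{i,j} J_{ij} σ_i σ_j`. -/
noncomputable def HSK (n : ℕ) (J : Fin n × Fin n → ℝ) (σ : Fin n → Bool) : ℝ :=
  -(Real.sqrt (2 * n))⁻¹ * ∑ p : Fin n × Fin n, J p * spin (σ p.1) * spin (σ p.2)

/-- The law of the i.i.d. standard Gaussian couplings `(J_{ij})`. -/
noncomputable def skMeasure (n : ℕ) : Measure ((Fin n × Fin n) → ℝ) :=
  Measure.pi fun _ => ProbabilityTheory.gaussianReal 0 1

open Classical in
/-- The cut size of the partition `(S, Sᶜ)` in the graph `G`. -/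
noncomputable def cutSize {n : ℕ} (G : SimpleGraph (Fin n)) (S : Finset (Fin n)) : ℕ :=
  ∑ i ∈ S, ∑ j ∈ Sᶜ, if G.Adj i j then 1 else 0

/-- `S` induces a bisection: the sizes of the two parts differ by at most one. -/
def IsBisection {n : ℕ} (S : Finset (Fin n)) : Prop :=
  (n : ℤ) - 1 ≤ 2 * S.card ∧ (2 * S.card : ℤ) ≤ n + 1

/-- Maximum bisection size. -/
noncomputable def MCUT {n : ℕ} (G : SimpleGraph (Fin n)) : ℕ :=
  sSup {k : ℕ | ∃ S : Finset (Fin n), IsBisection S ∧ cutSize G S = k}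

/-- Probability that a uniformly random element of the (finite) set `A`
lies in the set `B`. -/
noncomputable def probUniform {α : Type*} (A B : Set α) : ℝ :=
  ((A ∩ B).ncard : ℝ) / (A.ncard : ℝ)



lemma taylor3_pos {f f1 f2 f3 : ℝ → ℝ} (h1 : ∀ t, HasDerivAt f (f1 t) t)
    (h2 : ∀ t, HasDerivAt f1 (f2 t) t) (h3 : ∀ t, HasDerivAt f2 (f3 t) t) {M : ℝ}
    (hM : ∀ t, f3 t ≤ M) (t : ℝ) (ht : 0 ≤ t) :
    f t - f 0 - f1 0 * t - f2 0 * t ^ 2 / 2 ≤ M * t ^ 3 / 6 := by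
  have key : ∀ (g g' : ℝ → ℝ), (∀ t, HasDerivAt g (g' t) t) → (∀ t, 0 ≤ t → g' t ≤ 0) →
      g 0 ≤ 0 → ∀ t, 0 ≤ t → g t ≤ 0 := by
    intro g g' hg hg' h0 t ht
    have : AntitoneOn g (Set.Ici 0) := by
      apply antitoneOn_of_deriv_nonpos (convex_Ici 0)
      · exact fun x _ => (hg x).continuousAt.continuousWithinAt
      · exact fun x _ => (hg x).differentiableAt.differentiableWithinAt
      · intro x hx
        rw [interior_Ici] at hx
        rw [(hg x).deriv]
        exact hg' x hx.le
    exact (this (Set.mem_Ici.2 le_rfl) ht ht).trans h0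
  have e2 : ∀ t, 0 ≤ t → f2 t - f2 0 - M * t ≤ 0 := by
    apply key _ (fun t => f3 t - M)
    · intro t
      exact (((h3 t).sub_const (f2 0)).sub ((hasDerivAt_id t).const_mul M)).congr_deriv (by simp)
    · intro t _; linarith [hM t]
    · simp
  have e1 : ∀ t, 0 ≤ t → f1 t - f1 0 - f2 0 * t - M * t ^ 2 / 2 ≤ 0 := by
    apply key _ (fun t => f2 t - f2 0 - M * t) _ e2
    · simp
    · intro t
      have := (((h2 t).sub_const (f1 0)).sub ((hasDerivAt_id t).const_mul (f2 0))).sub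
        (((hasDerivAt_pow 2 t).const_mul M).div_const 2)
      exact this.congr_deriv (by simp; ring)
  have e0 : ∀ t, 0 ≤ t → f t - f 0 - f1 0 * t - f2 0 * t ^ 2 / 2 - M * t ^ 3 / 6 ≤ 0 := by
    apply key _ (fun t => f1 t - f1 0 - f2 0 * t - M * t ^ 2 / 2) _ e1
    · simp
    · intro t
      have := ((((h1 t).sub_const (f 0)).sub ((hasDerivAt_id t).const_mul (f1 0))).sub
        (((hasDerivAt_pow 2 t).const_mul (f2 0)).div_const 2)).sub
        (((hasDerivAt_pow 3 t).const_mul M).div_const 6)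
      exact this.congr_deriv (by simp; ring)
  linarith [e0 t ht]

lemma taylor3 {f f1 f2 f3 : ℝ → ℝ} (h1 : ∀ t, HasDerivAt f (f1 t) t)
    (h2 : ∀ t, HasDerivAt f1 (f2 t) t) (h3 : ∀ t, HasDerivAt f2 (f3 t) t) {M : ℝ}
    (hM : ∀ t, |f3 t| ≤ M) (t : ℝ) :
    |f t - f 0 - f1 0 * t - f2 0 * t ^ 2 / 2| ≤ M * |t| ^ 3 / 6 := by
  have main : ∀ {f f1 f2 f3 : ℝ → ℝ}, (∀ t, HasDerivAt f (f1 t) t) →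
    (∀ t, HasDerivAt f1 (f2 t) t) → (∀ t, HasDerivAt f2 (f3 t) t) →
    (∀ t, |f3 t| ≤ M) → ∀ t, 0 ≤ t →
    |f t - f 0 - f1 0 * t - f2 0 * t ^ 2 / 2| ≤ M * t ^ 3 / 6 := by
    intro f f1 f2 f3 h1 h2 h3 hM t ht
    rw [abs_le]
    constructor
    · have := taylor3_pos (fun t => (h1 t).neg) (fun t => (h2 t).neg) (fun t => (h3 t).neg)
        (M := M) (fun t => (neg_le_abs _).trans (hM t)) t ht
      simp only [Pi.neg_apply] at this
      linarith
    · exact taylor3_pos h1 h2 h3 (fun t => (le_abs_self _).trans (hM t)) t ht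
  rcases le_total 0 t with ht | ht
  · rw [abs_of_nonneg ht]
    exact main h1 h2 h3 hM t ht
  · have := main (f := fun t => f (-t)) (f1 := fun t => - f1 (-t)) (f2 := fun t => f2 (-t))
      (f3 := fun t => - f3 (-t)) ?_ ?_ ?_ ?_ (-t) (by linarith)
    · simp only [neg_neg, neg_zero] at this
      rw [abs_of_nonpos ht]
      convert this using 2
      ring
    · intro t
      exact ((h1 (-t)).scomp t (hasDerivAt_neg t)).congr_deriv (by simp)
    · intro t
      exact ((h2 (-t)).scomp t (hasDerivAt_neg t)).neg.congr_deriv (by simp)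
    · intro t
      exact ((h3 (-t)).scomp t (hasDerivAt_neg t)).congr_deriv (by simp)
    · intro t; simpa using hM (-t)

/-- one-dimensional log-partition function -/
lemma logcosh_taylor {A B β : ℝ} (hA : 0 ≤ A) (hB : 0 ≤ B) (hAB : 0 < A + B) (hβ : 0 < β) :
    ∃ a b : ℝ, ∀ t : ℝ, |β⁻¹ * Real.log (A * Real.exp (β * t) + B * Real.exp (-(β * t)))
      - β⁻¹ * Real.log (A + B) - a * t - b * t ^ 2| ≤ β ^ 2 * |t| ^ 3 / 3 := by
  set E : ℝ → ℝ := fun t => Real.exp (β * t)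
  set E' : ℝ → ℝ := fun t => Real.exp (-(β * t))
  have hE : ∀ t, HasDerivAt E (β * E t) t := by
    intro t
    have := ((hasDerivAt_id t).const_mul β).exp
    simpa [E, mul_comm] using this
  have hE' : ∀ t, HasDerivAt E' (-(β * E' t)) t := by
    intro t
    have := (((hasDerivAt_id t).const_mul β).neg).exp
    simpa [E', mul_comm] using this
  set S : ℝ → ℝ := fun t => A * E t + B * E' t
  set Dd : ℝ → ℝ := fun t => A * E t - B * E' t
  have hEp : ∀ t, 0 < E t := fun t => Real.exp_pos _
  have hEp' : ∀ t, 0 < E' t := fun t => Real.exp_pos _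
  have hS : ∀ t, 0 < S t := by
    intro t
    rcases hA.lt_or_eq with h | h
    · have := mul_pos h (hEp t); have := mul_nonneg hB (hEp' t).le
      simp only [S]; linarith
    · have hB' : 0 < B := by linarith
      have := mul_pos hB' (hEp' t); have := mul_nonneg hA (hEp t).le
      simp only [S]; linarith
  have hdS : ∀ t, HasDerivAt S (β * Dd t) t := by
    intro t
    refine HasDerivAt.congr_deriv (((hE t).const_mul A).add ((hE' t).const_mul B)) ?_
    simp only [Dd]; ring
  have hdD : ∀ t, HasDerivAt Dd (β * S t) t := by
    intro t
    refine HasDerivAt.congr_deriv (((hE t).const_mul A).sub ((hE' t).const_mul B)) ?_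
    simp only [S]; ring
  set u : ℝ → ℝ := fun t => Dd t / S t
  have hdu : ∀ t, HasDerivAt u (β * (1 - u t ^ 2)) t := by
    intro t
    refine HasDerivAt.congr_deriv ((hdD t).div (hdS t) (hS t).ne') ?_
    simp only [u]
    have := (hS t).ne'
    field_simp
  have hu : ∀ t, |u t| ≤ 1 := by
    intro t
    simp only [u]
    rw [abs_div, abs_of_pos (hS t), div_le_one (hS t), abs_le]
    have := mul_nonneg hA (hEp t).le
    have := mul_nonneg hB (hEp' t).le
    simp only [Dd, S]
    constructor <;> linarith
  have h1 : ∀ t, HasDerivAt (fun t => β⁻¹ * Real.log (S t)) (u t) t := by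
    intro t
    refine HasDerivAt.congr_deriv (((hdS t).log (hS t).ne').const_mul β⁻¹) ?_
    simp only [u]
    field_simp
  have h3 : ∀ t, HasDerivAt (fun t => β * (1 - u t ^ 2)) (- 2 * β ^ 2 * (u t * (1 - u t ^ 2))) t := by
    intro t
    refine HasDerivAt.congr_deriv ((((hdu t).pow 2).const_sub 1).const_mul β) ?_
    simp; ring
  refine ⟨u 0, β * (1 - u 0 ^ 2) / 2, fun t => ?_⟩
  have := taylor3 h1 hdu h3 (M := 2 * β ^ 2) ?_ t
  · have hS0 : S 0 = A + B := by simp [S, E, E']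
    rw [hS0] at this
    convert this using 1
    · congr 1
      ring
    · ring
  · intro t
    have h := hu t
    have h' : |1 - u t ^ 2| ≤ 1 := by
      rw [abs_le] at h ⊢
      constructor <;> nlinarith
    rw [abs_mul, abs_mul (u t)]
    have h2 : |(-2 : ℝ) * β ^ 2| = 2 * β ^ 2 := by rw [abs_mul]; simp
    rw [h2]
    have : |u t| * |1 - u t ^ 2| ≤ 1 := mul_le_one₀ h (abs_nonneg _) h'
    nlinarith [sq_nonneg β]


def CLip {ι : Type*} [Fintype ι] (L : ℝ) (f : (ι → ℝ) → ℝ) : Prop :=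
  ∀ x y, |f x - f y| ≤ L * ∑ i, |x i - y i|

lemma CLip.continuous {ι : Type*} [Fintype ι] {L : ℝ} {f : (ι → ℝ) → ℝ} (h : CLip L f) :
    Continuous f := by
  rw [continuous_iff_continuousAt]
  intro x
  have h0 : Tendsto (fun y : ι → ℝ => L * ∑ i, |y i - x i|) (nhds x) (nhds 0) := by
    have : Continuous (fun y : ι → ℝ => L * ∑ i, |y i - x i|) := by fun_prop
    simpa using this.tendsto x
  rw [ContinuousAt, tendsto_iff_norm_sub_tendsto_zero]
  exact squeeze_zero (fun _ => norm_nonneg _) (fun y => h y x) h0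

lemma CLip.memLp {ι : Type*} [Fintype ι] {L : ℝ} {f : (ι → ℝ) → ℝ} (h : CLip L f)
    {μ : Measure ℝ} [IsProbabilityMeasure μ] (hμ : MemLp id 2 μ) :
    MemLp f 2 (Measure.pi fun _ : ι => μ) := by
  have hi : ∀ i, MemLp (fun x : ι → ℝ => x i) 2 (Measure.pi fun _ : ι => μ) := fun i =>
    hμ.comp_measurePreserving (measurePreserving_eval (fun _ : ι => μ) i)
  have hs : MemLp (fun x : ι → ℝ => |f 0| + L * ∑ i, |x i|) 2 (Measure.pi fun _ : ι => μ) := by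
    have hA : MemLp (fun _ : ι → ℝ => |f 0|) 2 (Measure.pi fun _ : ι => μ) := memLp_const _
    have hn : ∀ i, MemLp (fun x : ι → ℝ => |x i|) 2 (Measure.pi fun _ : ι => μ) :=
      fun i => (hi i).norm
    have hB : MemLp (fun x : ι → ℝ => ∑ i, |x i|) 2 (Measure.pi fun _ : ι => μ) :=
      memLp_finsetSum _ (fun i _ => hn i)
    exact hA.add (hB.const_mul L)
  refine hs.mono' h.continuous.aestronglyMeasurable (Eventually.of_forall fun x => ?_)
  have := h x 0
  simp only [Pi.zero_apply, sub_zero] at this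
  rw [Real.norm_eq_abs]
  have := abs_sub_abs_le_abs_sub (f x) (f 0)
  linarith

lemma CLip.integrable {ι : Type*} [Fintype ι] {L : ℝ} {f : (ι → ℝ) → ℝ} (h : CLip L f)
    {μ : Measure ℝ} [IsProbabilityMeasure μ] (hμ : MemLp id 2 μ) :
    Integrable f (Measure.pi fun _ : ι => μ) := (h.memLp hμ).integrable (by norm_num)

lemma integral_pi_succ {N : ℕ} (μ : Measure ℝ) [IsProbabilityMeasure μ]
    (f : (Fin (N + 1) → ℝ) → ℝ) (hf : Integrable f (Measure.pi fun _ => μ)) :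
    ∫ x, f x ∂(Measure.pi fun _ => μ) =
      ∫ y, ∫ a, f (Fin.cons a y) ∂μ ∂(Measure.pi fun _ : Fin N => μ) := by
  have mp := (measurePreserving_piFinSuccAbove (fun _ : Fin (N + 1) => μ) 0).symm
  rw [← mp.integral_comp', integral_prod_symm]
  · have key : ∀ (a : ℝ) (y : Fin N → ℝ),
        (MeasurableEquiv.piFinSuccAbove (fun _ : Fin (N + 1) => ℝ) 0).symm (a, y)
          = (Fin.cons a y : Fin (N + 1) → ℝ) := by
      intro a y
      simp [MeasurableEquiv.piFinSuccAbove, Fin.insertNthEquiv]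
    simp only [key]
  · exact mp.integrable_comp_of_integrable hf

lemma CLip.cons {N : ℕ} {L : ℝ} {f : (Fin (N + 1) → ℝ) → ℝ} (h : CLip L f) (y : Fin N → ℝ)
    (a b : ℝ) : |f (Fin.cons a y) - f (Fin.cons b y)| ≤ L * |a - b| := by
  simpa [Fin.sum_univ_succ] using h (Fin.cons a y) (Fin.cons b y)

lemma CLip.cons_right {N : ℕ} {L : ℝ} {f : (Fin (N + 1) → ℝ) → ℝ} (h : CLip L f) (a : ℝ) :
    CLip L (fun y : Fin N → ℝ => f (Fin.cons a y)) := by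
  intro x y
  simpa [Fin.sum_univ_succ] using h (Fin.cons a x) (Fin.cons a y)

lemma lip1_memLp {L : ℝ} {g : ℝ → ℝ} (hL : ∀ a b, |g a - g b| ≤ L * |a - b|)
    {μ : Measure ℝ} [IsProbabilityMeasure μ] (hμ : MemLp id 2 μ) : MemLp g 2 μ := by
  have hc : Continuous g := by
    rw [continuous_iff_continuousAt]
    intro x
    have h0 : Tendsto (fun y : ℝ => L * |y - x|) (nhds x) (nhds 0) := by
      have : Continuous (fun y : ℝ => L * |y - x|) := by fun_prop
      simpa using this.tendsto x
    rw [ContinuousAt, tendsto_iff_norm_sub_tendsto_zero]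
    exact squeeze_zero (fun _ => norm_nonneg _) (fun y => hL y x) h0
  have hs : MemLp (fun x : ℝ => |g 0| + L * |x|) 2 μ := by
    have hA : MemLp (fun _ : ℝ => |g 0|) 2 μ := memLp_const _
    have hB : MemLp (fun x : ℝ => |x|) 2 μ := hμ.norm
    exact hA.add (hB.const_mul L)
  refine hs.mono' hc.aestronglyMeasurable (Eventually.of_forall fun x => ?_)
  have := hL x 0
  simp only [sub_zero] at this
  rw [Real.norm_eq_abs]
  have := abs_sub_abs_le_abs_sub (g x) (g 0)
  linarith

lemma CLip.cons_integrable {N : ℕ} {L : ℝ} {f : (Fin (N + 1) → ℝ) → ℝ} (h : CLip L f)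
    (y : Fin N → ℝ) {μ : Measure ℝ} [IsProbabilityMeasure μ] (hμ : MemLp id 2 μ) :
    Integrable (fun a => f (Fin.cons a y)) μ :=
  (lip1_memLp (h.cons y) hμ).integrable (by norm_num)

lemma CLip.integral_cons {N : ℕ} {L : ℝ} {f : (Fin (N + 1) → ℝ) → ℝ} (h : CLip L f)
    {μ : Measure ℝ} [IsProbabilityMeasure μ] (hμ : MemLp id 2 μ) :
    CLip L (fun y : Fin N → ℝ => ∫ a, f (Fin.cons a y) ∂μ) := by
  intro x y
  have hx := h.cons_integrable x hμ
  have hy := h.cons_integrable y hμ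
  simp only
  rw [← integral_sub hx hy]
  have := norm_integral_le_of_norm_le_const (μ := μ)
    (f := fun a => f (Fin.cons a x) - f (Fin.cons a y))
    (C := L * ∑ i, |x i - y i|) (Eventually.of_forall fun a => by
      simpa using h.cons_right a x y)
  simpa using this

lemma int_sq_le {g : ℝ → ℝ} {L : ℝ} (hL : ∀ a b, |g a - g b| ≤ L * |a - b|)
    {μ : Measure ℝ} [IsProbabilityMeasure μ] (hμ : MemLp id 2 μ) (c : ℝ) :
    ∫ a, (g a - c) ^ 2 ∂μ ≤ L ^ 2 * ∫ x, x ^ 2 ∂μ + ((∫ a, g a ∂μ) - c) ^ 2 := by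
  have hg := lip1_memLp hL hμ
  have hgi : Integrable g μ := hg.integrable (by norm_num)
  have hg2 : Integrable (fun a => g a ^ 2) μ := hg.integrable_sq
  have e : ∀ c, ∫ a, (g a - c) ^ 2 ∂μ = ∫ a, g a ^ 2 ∂μ - 2 * c * ∫ a, g a ∂μ + c ^ 2 := by
    intro c
    have : ∀ a, (g a - c) ^ 2 = g a ^ 2 - 2 * c * g a + c ^ 2 := fun a => by ring
    simp_rw [this]
    have hi1 : Integrable (fun a => 2 * c * g a) μ := hgi.const_mul _
    have hi2 : Integrable (fun a => g a ^ 2 - 2 * c * g a) μ := hg2.sub hi1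
    rw [integral_add hi2 (integrable_const _), integral_sub hg2 hi1, integral_const_mul]
    simp
  have h1 : ∫ a, (g a - g 0) ^ 2 ∂μ ≤ L ^ 2 * ∫ x, x ^ 2 ∂μ := by
    rw [← integral_const_mul]
    apply integral_mono
    · exact (hg.sub (memLp_const (g 0))).integrable_sq
    · exact hμ.integrable_sq.const_mul _
    · intro a
      have := hL a 0
      rw [sub_zero] at this
      simp only
      rw [← mul_pow, ← sq_abs (g a - g 0), ← sq_abs (L * a)]
      refine pow_le_pow_left₀ (abs_nonneg _) (this.trans ?_) 2
      rw [abs_mul]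
      exact mul_le_mul_of_nonneg_right (le_abs_self _) (abs_nonneg _)
  rw [e] at h1 ⊢
  nlinarith [sq_nonneg ((∫ a, g a ∂μ) - g 0)]

/-- Efron-Stein type bound. -/
lemma var_fin {μ : Measure ℝ} [IsProbabilityMeasure μ] (hμ : MemLp id 2 μ) (L : ℝ) (N : ℕ) :
    ∀ (f : (Fin N → ℝ) → ℝ), CLip L f → ∀ c,
      ∫ x, (f x - c) ^ 2 ∂(Measure.pi fun _ => μ) ≤
        N * (L ^ 2 * ∫ x, x ^ 2 ∂μ) + ((∫ x, f x ∂(Measure.pi fun _ => μ)) - c) ^ 2 := by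
  induction N with
  | zero =>
    intro f _ c
    have : ∀ x, f x = f 0 := fun x => by rw [Subsingleton.elim x 0]
    simp_rw [this]
    simp
  | succ N ih =>
    intro f hf c
    have hsq : Integrable (fun x => (f x - c) ^ 2) (Measure.pi fun _ : Fin (N+1) => μ) :=
      ((hf.memLp hμ).sub (memLp_const c)).integrable_sq
    rw [integral_pi_succ μ _ hsq, integral_pi_succ μ _ (hf.integrable hμ)]
    have hh := hf.integral_cons hμ
    have := ih _ hh c
    have hb : ∫ y, ∫ a, (f (Fin.cons a y) - c) ^ 2 ∂μ ∂(Measure.pi fun _ : Fin N => μ) ≤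
        ∫ y, (L ^ 2 * ∫ x, x ^ 2 ∂μ + ((∫ a, f (Fin.cons a y) ∂μ) - c) ^ 2)
          ∂(Measure.pi fun _ : Fin N => μ) := by
      have hIntg : Integrable (fun y => L ^ 2 * ∫ x, x ^ 2 ∂μ + ((∫ a, f (Fin.cons a y) ∂μ) - c) ^ 2)
          (Measure.pi fun _ : Fin N => μ) :=
        (integrable_const _).add ((hh.memLp hμ).sub (memLp_const c)).integrable_sq
      refine integral_mono_of_nonneg (Eventually.of_forall fun y => ?_) hIntg
        (Eventually.of_forall fun y => ?_)
      · exact integral_nonneg fun a => sq_nonneg _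
      · exact int_sq_le (hf.cons y) hμ c
    have hIntg2 : Integrable (fun y => ((∫ a, f (Fin.cons a y) ∂μ) - c) ^ 2)
          (Measure.pi fun _ : Fin N => μ) :=
        ((hh.memLp hμ).sub (memLp_const c)).integrable_sq
    rw [integral_add (integrable_const _) hIntg2] at hb
    simp only [integral_const, probReal_univ, smul_eq_mul, one_mul] at hb
    push_cast
    linarith

/-- Lindeberg replacement. -/
lemma lindeberg_fin {μ ν : Measure ℝ} [IsProbabilityMeasure μ] [IsProbabilityMeasure ν]
    (hμ : MemLp id 2 μ) (hν : MemLp id 2 ν) (L e : ℝ) (N : ℕ) :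
    ∀ (f : (Fin N → ℝ) → ℝ), CLip L f →
      (∀ x i, |∫ t, f (Function.update x i t) ∂μ - ∫ t, f (Function.update x i t) ∂ν| ≤ e) →
      |∫ x, f x ∂(Measure.pi fun _ => μ) - ∫ x, f x ∂(Measure.pi fun _ => ν)| ≤ N * e := by
  induction N with
  | zero =>
    intro f _ _
    have : ∀ x, f x = f 0 := fun x => by rw [Subsingleton.elim x 0]
    simp_rw [this]
    simp
  | succ N ih =>
    intro f hf he
    rw [integral_pi_succ μ _ (hf.integrable hμ), integral_pi_succ ν _ (hf.integrable hν)]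
    have hh := hf.integral_cons hμ
    have hh' := hf.integral_cons hν
    have upd : ∀ (y : Fin N → ℝ) (i : Fin N) (a t : ℝ),
        (Fin.cons a (Function.update y i t) : Fin (N+1) → ℝ)
          = Function.update (Fin.cons a y : Fin (N+1) → ℝ) i.succ t := fun y i a t => by
      rw [Fin.cons_update]
    have swap : ∀ (ρ : Measure ℝ) [IsProbabilityMeasure ρ], MemLp id 2 ρ →
        ∀ (y : Fin N → ℝ) (i : Fin N),
        Integrable (fun a => ∫ t, f (Function.update (Fin.cons a y : Fin (N+1) → ℝ) i.succ t) ∂ρ) μ ∧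
        ∫ t, ∫ a, f (Fin.cons a (Function.update y i t)) ∂μ ∂ρ =
          ∫ a, ∫ t, f (Function.update (Fin.cons a y : Fin (N+1) → ℝ) i.succ t) ∂ρ ∂μ := by
      intro ρ _ hρ y i
      have hIntg : Integrable (Function.uncurry fun (t a : ℝ) => f (Fin.cons a (Function.update y i t)))
          (ρ.prod μ) := by
        have hd : Integrable (fun z : ℝ × ℝ => |f 0| + L * (|z.2| + (|z.1| + ∑ j, |y j|)))
            (ρ.prod μ) := by
          have h1 : Integrable (fun z : ℝ × ℝ => |z.1|) (ρ.prod μ) :=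
            ((hρ.integrable (by norm_num)).comp_fst μ).abs
          have h2 : Integrable (fun z : ℝ × ℝ => |z.2|) (ρ.prod μ) :=
            ((hμ.integrable (by norm_num)).comp_snd ρ).abs
          exact (integrable_const _).add ((h2.add (h1.add (integrable_const _))).const_mul L)
        refine hd.mono' ?_ (Eventually.of_forall fun z => ?_)
        · apply Continuous.aestronglyMeasurable
          refine hf.continuous.comp ?_
          refine continuous_pi fun j => ?_
          refine Fin.cases ?_ (fun j => ?_) j
          · simpa using continuous_snd
          · simp only [Fin.cons_succ]
            by_cases hj : j = i
            · subst hj; simpa using continuous_fst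
            · simpa [Function.update_of_ne hj] using continuous_const
        · have hL : 0 ≤ L := by
            have := hf (Fin.cons 1 0) (Fin.cons 0 0)
            simp [Fin.sum_univ_succ] at this
            exact (abs_nonneg _).trans this
          have h0 := hf (Fin.cons z.2 (Function.update y i z.1)) 0
          have h1 : ∑ j, |(Fin.cons z.2 (Function.update y i z.1) : Fin (N+1) → ℝ) j - (0 : Fin (N+1) → ℝ) j|
              ≤ |z.2| + (|z.1| + ∑ j, |y j|) := by
            rw [Fin.sum_univ_succ]
            simp only [Fin.cons_zero, Pi.zero_apply, sub_zero, Fin.cons_succ]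
            gcongr
            calc ∑ j, |Function.update y i z.1 j| ≤ ∑ j, ((if j = i then |z.1| else 0) + |y j|) := by
                  apply Finset.sum_le_sum
                  intro j _
                  by_cases hj : j = i
                  · subst hj; simp
                  · simp [hj]
              _ = _ := by rw [Finset.sum_add_distrib]; simp
          have h2 := mul_le_mul_of_nonneg_left h1 hL
          rw [Real.norm_eq_abs]
          simp only [Function.uncurry]
          have := abs_sub_abs_le_abs_sub (f (Fin.cons z.2 (Function.update y i z.1))) (f 0)
          linarith
      constructor
      · have := hIntg.integral_prod_right
        simpa only [Function.uncurry, upd] using this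
      · rw [integral_integral_swap hIntg]
        simp only [upd]
    have h1 := ih _ hh (by
      intro y i
      obtain ⟨i1, e1⟩ := swap μ hμ y i
      obtain ⟨i2, e2⟩ := swap ν hν y i
      rw [e1, e2, ← integral_sub i1 i2]
      have := norm_integral_le_of_norm_le_const (μ := μ) (C := e)
        (f := fun a => ∫ t, f (Function.update (Fin.cons a y : Fin (N+1) → ℝ) i.succ t) ∂μ -
          ∫ t, f (Function.update (Fin.cons a y : Fin (N+1) → ℝ) i.succ t) ∂ν)
        (Eventually.of_forall fun a => he _ _)
      simpa using this)
    have h2 : |∫ y, ∫ a, f (Fin.cons a y) ∂μ ∂(Measure.pi fun _ : Fin N => ν) -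
        ∫ y, ∫ a, f (Fin.cons a y) ∂ν ∂(Measure.pi fun _ : Fin N => ν)| ≤ e := by
      rw [← integral_sub (hh.integrable hν) (hh'.integrable hν)]
      have := norm_integral_le_of_norm_le_const (μ := (Measure.pi fun _ : Fin N => ν)) (C := e)
        (f := fun y => ∫ a, f (Fin.cons a y) ∂μ - ∫ a, f (Fin.cons a y) ∂ν)
        (Eventually.of_forall fun y => by
          have he' := he (Fin.cons 0 y) 0
          simp only [Fin.update_cons_zero] at he'
          exact he')
      simpa using this
    push_cast
    have := abs_sub_le (∫ y, ∫ a, f (Fin.cons a y) ∂μ ∂(Measure.pi fun _ : Fin N => μ))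
      (∫ y, ∫ a, f (Fin.cons a y) ∂μ ∂(Measure.pi fun _ : Fin N => ν))
      (∫ y, ∫ a, f (Fin.cons a y) ∂ν ∂(Measure.pi fun _ : Fin N => ν))
    linarith


lemma pi_reindex {ι : Type*} [Fintype ι] (μ : Measure ℝ) [IsProbabilityMeasure μ]
    {N : ℕ} (e : Fin N ≃ ι) (f : (ι → ℝ) → ℝ) :
    ∫ x, f x ∂(Measure.pi fun _ : ι => μ) =
      ∫ y, f (fun i => y (e.symm i)) ∂(Measure.pi fun _ : Fin N => μ) := by
  have mp := measurePreserving_piCongrLeft (fun _ : ι => μ) e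
  rw [← mp.integral_comp']
  congr 1
  ext y
  congr 1
  ext i
  obtain ⟨j, rfl⟩ := e.surjective i
  rw [MeasurableEquiv.piCongrLeft_apply_apply]
  simp

lemma CLip.reindex {ι : Type*} [Fintype ι] {N : ℕ} (e : Fin N ≃ ι) {L : ℝ} {f : (ι → ℝ) → ℝ}
    (h : CLip L f) : CLip L (fun y : Fin N → ℝ => f (fun i => y (e.symm i))) := by
  intro x y
  have := h (fun i => x (e.symm i)) (fun i => y (e.symm i))
  rwa [Equiv.sum_comp e.symm (fun i => |x i - y i|)] at this

lemma var_pi {ι : Type*} [Fintype ι] {μ : Measure ℝ} [IsProbabilityMeasure μ]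
    (hμ : MemLp id 2 μ) {L : ℝ} {f : (ι → ℝ) → ℝ} (hf : CLip L f) :
    ∫ x, (f x - ∫ y, f y ∂(Measure.pi fun _ => μ)) ^ 2 ∂(Measure.pi fun _ => μ) ≤
        Fintype.card ι * (L ^ 2 * ∫ x, x ^ 2 ∂μ) := by
  have e := (Fintype.equivFin ι).symm
  rw [pi_reindex μ e, pi_reindex μ e f]
  have := var_fin hμ L _ _ (hf.reindex e)
    (∫ y, f (fun i => y (e.symm i)) ∂(Measure.pi fun _ : Fin _ => μ))
  simpa using this

lemma lindeberg_pi {ι : Type*} [Fintype ι] [DecidableEq ι] {μ ν : Measure ℝ}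
    [IsProbabilityMeasure μ] [IsProbabilityMeasure ν]
    (hμ : MemLp id 2 μ) (hν : MemLp id 2 ν) {L e : ℝ} {f : (ι → ℝ) → ℝ} (hf : CLip L f)
    (he : ∀ x i, |∫ t, f (Function.update x i t) ∂μ - ∫ t, f (Function.update x i t) ∂ν| ≤ e) :
    |∫ x, f x ∂(Measure.pi fun _ => μ) - ∫ x, f x ∂(Measure.pi fun _ => ν)|
      ≤ Fintype.card ι * e := by
  have eq := (Fintype.equivFin ι).symm
  rw [pi_reindex μ eq, pi_reindex ν eq f]
  refine lindeberg_fin hμ hν L e _ _ (hf.reindex eq) ?_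
  intro x i
  have := he (fun i => x (eq.symm i)) (eq i)
  convert this using 6 <;>
  · ext j
    by_cases h : j = eq i
    · subst h; simp
    · have h' : eq.symm j ≠ i := fun h2 => h (by rw [← h2]; simp)
      simp [h, h']

/-- Maximum of a family of linear functionals. -/
noncomputable def Mx {ι κ : Type*} [Fintype ι] (v : κ → ι → ℝ) (x : ι → ℝ) : ℝ :=
  ⨆ k, ∑ e, x e * v k e

/-- Soft maximum. -/
noncomputable def LS {ι κ : Type*} [Fintype ι] [Fintype κ] (β : ℝ) (v : κ → ι → ℝ)
    (x : ι → ℝ) : ℝ :=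
  β⁻¹ * Real.log (∑ k, Real.exp (β * ∑ e, x e * v k e))

section
set_option linter.unusedSectionVars false
variable {ι κ : Type*} [Fintype ι] [Fintype κ] [Nonempty κ] {v : κ → ι → ℝ}

lemma le_Mx (x : ι → ℝ) (k : κ) : ∑ e, x e * v k e ≤ Mx v x :=
  le_ciSup (f := fun k => ∑ e, x e * v k e) (Finite.bddAbove_range _) k

lemma Mx_le {x : ι → ℝ} {c : ℝ} (h : ∀ k : κ, ∑ e, x e * v k e ≤ c) : Mx v x ≤ c :=
  ciSup_le h

lemma exists_Mx (v : κ → ι → ℝ) (x : ι → ℝ) : ∃ k, Mx v x = ∑ e, x e * v k e := by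
  obtain ⟨k, hk⟩ := exists_eq_ciSup_of_finite (f := fun k => ∑ e, x e * v k e)
  exact ⟨k, hk.symm⟩

lemma lin_diff (hv : ∀ k e, |v k e| = 1) (x y : ι → ℝ) (k : κ) :
    ∑ e, x e * v k e ≤ ∑ e, y e * v k e + ∑ e, |x e - y e| := by
  rw [← Finset.sum_add_distrib]
  apply Finset.sum_le_sum
  intro e _
  have h1 : (x e - y e) * v k e ≤ |x e - y e| := by
    have := le_abs_self ((x e - y e) * v k e)
    rwa [abs_mul, hv, mul_one] at this
  linarith

lemma Mx_lip (hv : ∀ k e, |v k e| = 1) : CLip 1 (Mx v) := by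
  have h : ∀ x y, Mx v x ≤ Mx v y + ∑ e, |x e - y e| := fun x y =>
    Mx_le fun k => (lin_diff hv x y k).trans (by gcongr; exact le_Mx y k)
  intro x y
  rw [one_mul, abs_le]
  have h1 := h x y
  have h2 := h y x
  simp_rw [abs_sub_comm (y _)] at h2
  constructor <;> linarith

lemma sum_exp_pos (β : ℝ) (x : ι → ℝ) : 0 < ∑ k, Real.exp (β * ∑ e, x e * v k e) :=
  Finset.sum_pos (fun _ _ => Real.exp_pos _) Finset.univ_nonempty

lemma LS_lip (hv : ∀ k e, |v k e| = 1) {β : ℝ} (hβ : 0 < β) : CLip 1 (LS β v) := by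
  have h : ∀ x y, LS β v x ≤ LS β v y + ∑ e, |x e - y e| := by
    intro x y
    have h1 : ∑ k, Real.exp (β * ∑ e, x e * v k e) ≤
        Real.exp (β * ∑ e, |x e - y e|) * ∑ k, Real.exp (β * ∑ e, y e * v k e) := by
      rw [Finset.mul_sum]
      apply Finset.sum_le_sum
      intro k _
      rw [← Real.exp_add]
      apply Real.exp_le_exp.2
      have := mul_le_mul_of_nonneg_left (lin_diff hv x y k) hβ.le
      linarith
    have h2 := Real.log_le_log (sum_exp_pos β x) h1
    rw [Real.log_mul (Real.exp_pos _).ne' (sum_exp_pos β y).ne', Real.log_exp] at h2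
    have h3 := mul_le_mul_of_nonneg_left h2 (inv_pos.2 hβ).le
    rw [mul_add, ← mul_assoc, inv_mul_cancel₀ hβ.ne', one_mul] at h3
    simp only [LS]; linarith
  intro x y
  rw [one_mul, abs_le]
  have h1 := h x y
  have h2 := h y x
  simp_rw [abs_sub_comm (y _)] at h2
  constructor <;> linarith

lemma Mx_le_LS {β : ℝ} (hβ : 0 < β) (x : ι → ℝ) : Mx v x ≤ LS β v x := by
  obtain ⟨k, hk⟩ := exists_Mx v x
  have h1 : Real.exp (β * Mx v x) ≤ ∑ k, Real.exp (β * ∑ e, x e * v k e) := by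
    rw [hk]
    exact Finset.single_le_sum (f := fun k => Real.exp (β * ∑ e, x e * v k e))
      (fun _ _ => (Real.exp_pos _).le) (Finset.mem_univ k)
  have h2 := Real.log_le_log (Real.exp_pos _) h1
  rw [Real.log_exp] at h2
  rw [LS, inv_mul_eq_div, le_div_iff₀ hβ]
  linarith

lemma LS_le_Mx {β : ℝ} (hβ : 0 < β) (x : ι → ℝ) :
    LS β v x ≤ Mx v x + β⁻¹ * Real.log (Fintype.card κ) := by
  have h1 : ∑ k, Real.exp (β * ∑ e, x e * v k e) ≤ Fintype.card κ * Real.exp (β * Mx v x) := by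
    rw [← nsmul_eq_mul, ← Finset.card_univ]
    apply Finset.sum_le_card_nsmul
    intro k _
    apply Real.exp_le_exp.2
    exact mul_le_mul_of_nonneg_left (le_Mx x k) hβ.le
  have h2 := Real.log_le_log (sum_exp_pos β x) h1
  have hc : (0 : ℝ) < Fintype.card κ := by exact_mod_cast Fintype.card_pos
  rw [Real.log_mul hc.ne' (Real.exp_pos _).ne', Real.log_exp] at h2
  have h3 := mul_le_mul_of_nonneg_left h2 (inv_pos.2 hβ).le
  rw [mul_add, ← mul_assoc β⁻¹ β, inv_mul_cancel₀ hβ.ne', one_mul] at h3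
  simp only [LS]; linarith

lemma Mx_smul {c : ℝ} (hc : 0 ≤ c) (x : ι → ℝ) : Mx v (fun e => c * x e) = c * Mx v x := by
  simp only [Mx]
  rw [Real.mul_iSup_of_nonneg hc]
  congr 1
  ext k
  rw [Finset.mul_sum]
  exact Finset.sum_congr rfl fun e _ => by ring

/-- Taylor expansion of the soft max in one coordinate. -/
lemma LS_taylor [DecidableEq ι] (hv : ∀ k e, v k e = 1 ∨ v k e = -1) {β : ℝ} (hβ : 0 < β)
    (x : ι → ℝ) (i : ι) : ∃ a b c : ℝ, ∀ t : ℝ,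
      |LS β v (Function.update x i t) - c - a * t - b * t ^ 2| ≤ β ^ 2 * |t| ^ 3 / 3 := by
  classical
  set w : κ → ℝ := fun k => Real.exp (β * ∑ e ∈ univ.erase i, x e * v k e)
  have hw : ∀ k, 0 < w k := fun k => Real.exp_pos _
  set A := ∑ k with v k i = 1, w k
  set B := ∑ k with ¬ v k i = 1, w k
  have hA : 0 ≤ A := Finset.sum_nonneg fun k _ => (hw k).le
  have hB : 0 ≤ B := Finset.sum_nonneg fun k _ => (hw k).le
  have hAB : 0 < A + B := by
    rw [Finset.sum_filter_add_sum_filter_not]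
    exact Finset.sum_pos (fun k _ => hw k) Finset.univ_nonempty
  obtain ⟨a, b, h⟩ := logcosh_taylor hA hB hAB hβ
  refine ⟨a, b, β⁻¹ * Real.log (A + B), fun t => ?_⟩
  convert h t using 6
  rw [LS]
  congr 2
  rw [← Finset.sum_filter_add_sum_filter_not univ (fun k => v k i = 1), Finset.sum_mul,
    Finset.sum_mul]
  have split : ∀ k, ∑ e, Function.update x i t e * v k e
      = t * v k i + ∑ e ∈ univ.erase i, x e * v k e := by
    intro k
    rw [← Finset.add_sum_erase _ _ (Finset.mem_univ i)]
    congr 1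
    · simp
    · apply Finset.sum_congr rfl
      intro e he
      rw [Function.update_of_ne (Finset.ne_of_mem_erase he)]
  congr 1
  · apply Finset.sum_congr rfl
    intro k hk
    rw [Finset.mem_filter] at hk
    rw [split, hk.2, ← Real.exp_add]
    congr 1; ring
  · apply Finset.sum_congr rfl
    intro k hk
    rw [Finset.mem_filter] at hk
    have : v k i = -1 := (hv k i).resolve_left hk.2
    rw [split, this, ← Real.exp_add]
    congr 1; ring

end

lemma moment_bound {μ : Measure ℝ} [IsProbabilityMeasure μ] (h2 : MemLp id 2 μ)
    (h3 : Integrable (fun t : ℝ => |t| ^ 3) μ) (h1 : ∫ t, t ∂μ = 0) {g : ℝ → ℝ} {a b c d : ℝ}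
    (hgi : Integrable g μ)
    (hg : ∀ t, |g t - c - a * t - b * t ^ 2| ≤ d * |t| ^ 3 / 3) :
    |∫ t, g t ∂μ - (c + b * ∫ t, t ^ 2 ∂μ)| ≤ d * (∫ t, |t| ^ 3 ∂μ) / 3 := by
  have i1 : Integrable (fun t : ℝ => t) μ := h2.integrable (by norm_num)
  have i2 : Integrable (fun t : ℝ => t ^ 2) μ := h2.integrable_sq
  have j0 : Integrable (fun t => g t - c) μ := hgi.sub (integrable_const c)
  have j1 : Integrable (fun t => g t - c - a * t) μ := j0.sub (i1.const_mul a)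
  have e : ∫ t, (g t - c - a * t - b * t ^ 2) ∂μ = ∫ t, g t ∂μ - (c + b * ∫ t, t ^ 2 ∂μ) := by
    rw [integral_sub j1 (i2.const_mul b), integral_sub j0 (i1.const_mul a),
      integral_sub hgi (integrable_const c), integral_const_mul, integral_const_mul, h1]
    simp; ring
  rw [← e]
  have := norm_integral_le_of_norm_le (μ := μ) (f := fun t => g t - c - a * t - b * t ^ 2)
    (g := fun t => d * |t| ^ 3 / 3) ((h3.const_mul d).div_const 3) (Eventually.of_forall hg)
  rw [integral_div, integral_const_mul] at this
  exact this

/-- Lindeberg for the maximum. -/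
lemma lindeberg_Mx {ι κ : Type*} [Fintype ι] [Fintype κ] [Nonempty κ] {v : κ → ι → ℝ}
    (hv : ∀ k e, v k e = 1 ∨ v k e = -1) {μ ν : Measure ℝ}
    [IsProbabilityMeasure μ] [IsProbabilityMeasure ν]
    (hμ : MemLp id 2 μ) (hν : MemLp id 2 ν)
    (hμ3 : Integrable (fun t : ℝ => |t| ^ 3) μ) (hν3 : Integrable (fun t : ℝ => |t| ^ 3) ν)
    (hμ1 : ∫ t, t ∂μ = 0) (hν1 : ∫ t, t ∂ν = 0) (h22 : ∫ t, t ^ 2 ∂μ = ∫ t, t ^ 2 ∂ν)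
    {β : ℝ} (hβ : 0 < β) :
    |∫ x, Mx v x ∂(Measure.pi fun _ => μ) - ∫ x, Mx v x ∂(Measure.pi fun _ => ν)| ≤
      Fintype.card ι * (β ^ 2 * ((∫ t, |t| ^ 3 ∂μ) + ∫ t, |t| ^ 3 ∂ν) / 3)
        + β⁻¹ * Real.log (Fintype.card κ) := by
  classical
  have hv' : ∀ k e, |v k e| = 1 := fun k e => by rcases hv k e with h | h <;> simp [h]
  have hl := lindeberg_pi hμ hν (f := LS β v)
    (e := β ^ 2 * ((∫ t, |t| ^ 3 ∂μ) + ∫ t, |t| ^ 3 ∂ν) / 3) (LS_lip hv' hβ) (by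
    intro x i
    obtain ⟨a, b, c, h⟩ := LS_taylor hv hβ x i
    have hL : ∀ s t, |LS β v (Function.update x i s) - LS β v (Function.update x i t)|
        ≤ 1 * |s - t| := by
      intro s t
      refine (LS_lip hv' hβ _ _).trans (le_of_eq ?_)
      congr 1
      rw [Finset.sum_eq_single i]
      · simp
      · intro j _ hj; simp [hj]
      · simp
    have m1 := moment_bound hμ hμ3 hμ1 ((lip1_memLp hL hμ).integrable (by norm_num)) h
    have m2 := moment_bound hν hν3 hν1 ((lip1_memLp hL hν).integrable (by norm_num)) h
    rw [h22] at m1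
    rw [abs_le] at m1 m2 ⊢
    constructor <;> linarith [m1.1, m1.2, m2.1, m2.2])
  have sand : ∀ (ρ : Measure ℝ) [IsProbabilityMeasure ρ], MemLp id 2 ρ →
      ∫ x, Mx v x ∂(Measure.pi fun _ => ρ) ≤ ∫ x, LS β v x ∂(Measure.pi fun _ => ρ) ∧
      ∫ x, LS β v x ∂(Measure.pi fun _ => ρ) ≤ ∫ x, Mx v x ∂(Measure.pi fun _ => ρ)
        + β⁻¹ * Real.log (Fintype.card κ) := by
    intro ρ _ hρ
    have iM := (Mx_lip hv').integrable hρ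
    have iL := (LS_lip hv' hβ).integrable hρ
    refine ⟨integral_mono iM iL (fun x => Mx_le_LS hβ x), ?_⟩
    have := integral_mono iL (iM.add (integrable_const (β⁻¹ * Real.log (Fintype.card κ))))
      (fun x => LS_le_Mx (v := v) hβ x)
    simp only [Pi.add_apply] at this
    rw [integral_add iM (integrable_const _)] at this
    simpa using this
  have s1 := sand μ hμ
  have s2 := sand ν hν
  rw [abs_le] at hl ⊢
  constructor <;> linarith [hl.1, hl.2, s1.1, s1.2, s2.1, s2.2]


/-- Unordered pairs. -/
abbrev Pr (n : ℕ) : Type := {p : Fin n × Fin n // p.1 < p.2}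

noncomputable def vv (n : ℕ) (σ : Fin n → Bool) (e : Pr n) : ℝ := spin (σ e.1.1) * spin (σ e.1.2)

lemma spin_cases (b : Bool) : spin b = 1 ∨ spin b = -1 := by cases b <;> simp [spin]

lemma spin_sq (b : Bool) : spin b * spin b = 1 := by cases b <;> simp [spin]

lemma vv_cases (n : ℕ) (σ : Fin n → Bool) (e : Pr n) : vv n σ e = 1 ∨ vv n σ e = -1 := by
  simp only [vv]
  rcases spin_cases (σ e.1.1) with h | h <;> rcases spin_cases (σ e.1.2) with h' | h' <;>
    simp [h, h']

/-- All ordered pairs, as diagonal plus two copies of the unordered pairs. -/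
noncomputable def pairEquiv (n : ℕ) : (Fin n ⊕ (Pr n ⊕ Pr n)) ≃ Fin n × Fin n :=
  Equiv.ofBijective
    (Sum.elim (fun i => (i, i)) (Sum.elim (fun e => e.1) (fun e => e.1.swap))) (by
    constructor
    · rintro (i | ⟨⟨a, b⟩, h⟩ | ⟨⟨a, b⟩, h⟩) (j | ⟨⟨c, d⟩, h'⟩ | ⟨⟨c, d⟩, h'⟩) <;>
        simp only [Sum.elim_inl, Sum.elim_inr, Prod.swap_prod_mk, Prod.mk.injEq] <;>
        intro hh <;> grind
    · rintro ⟨a, b⟩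
      rcases lt_trichotomy a b with h | h | h
      · exact ⟨Sum.inr (Sum.inl ⟨(a, b), h⟩), rfl⟩
      · exact ⟨Sum.inl a, by simp [h]⟩
      · exact ⟨Sum.inr (Sum.inr ⟨(b, a), h⟩), rfl⟩)

lemma sum_pairs {n : ℕ} (F : Fin n × Fin n → ℝ) :
    ∑ p, F p = ∑ i, F (i, i) + ∑ e : Pr n, (F e.1 + F e.1.swap) := by
  rw [← Equiv.sum_comp (pairEquiv n), Fintype.sum_sum_type, Fintype.sum_sum_type,
    Finset.sum_add_distrib]
  rfl

lemma symm_mp (n : ℕ) : MeasurePreserving (fun (J : Fin n × Fin n → ℝ) (e : Pr n) =>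
    J e.1 + J e.1.swap) (skMeasure n)
    (Measure.pi fun _ : Pr n => ProbabilityTheory.gaussianReal 0 2) := by
  set γ := ProbabilityTheory.gaussianReal 0 1
  have m1 := (measurePreserving_piCongrLeft (fun _ : Fin n × Fin n => γ) (pairEquiv n)).symm
  have m2 := measurePreserving_sumPiEquivProdPi (fun _ : Fin n ⊕ (Pr n ⊕ Pr n) => γ)
  have m3 : MeasurePreserving Prod.snd ((Measure.pi fun _ : Fin n => γ).prod
    (Measure.pi fun _ : Pr n ⊕ Pr n => γ)) _ := measurePreserving_snd
  have m4 := measurePreserving_sumPiEquivProdPi (fun _ : Pr n ⊕ Pr n => γ)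
  have m5 := (measurePreserving_arrowProdEquivProdArrow ℝ ℝ (Pr n) (fun _ => γ) (fun _ => γ)).symm
  have hadd : MeasurePreserving (fun z : ℝ × ℝ => z.1 + z.2) (γ.prod γ)
      (ProbabilityTheory.gaussianReal 0 2) := by
    refine ⟨by fun_prop, ?_⟩
    have := ProbabilityTheory.gaussianReal_conv_gaussianReal (m₁ := 0) (m₂ := 0) (v₁ := 1) (v₂ := 1)
    rw [Measure.conv] at this
    rw [this]
    norm_num
  have m6 := measurePreserving_pi (fun _ : Pr n => γ.prod γ) 
    (fun _ : Pr n => ProbabilityTheory.gaussianReal 0 2) (fun _ => hadd)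
  have := m6.comp (m5.comp (m4.comp (m3.comp (m2.comp m1))))
  exact this

lemma memLp_gauss (v : NNReal) : MemLp id 2 (ProbabilityTheory.gaussianReal 0 v) :=
  ProbabilityTheory.memLp_id_gaussianReal' 2 (by norm_num)

lemma gauss_scale {ι : Type*} [Fintype ι] {s : ℝ} {v : NNReal} (hv : (v : ℝ) = s ^ 2)
    (f : (ι → ℝ) → ℝ) (hf : Continuous f) :
    ∫ x, f x ∂(Measure.pi fun _ : ι => ProbabilityTheory.gaussianReal 0 v) =
    ∫ x, f (fun e => s * x e) ∂(Measure.pi fun _ : ι => ProbabilityTheory.gaussianReal 0 1) := by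
  have h1 : MeasurePreserving (fun t : ℝ => s * t) (ProbabilityTheory.gaussianReal 0 1)
      (ProbabilityTheory.gaussianReal 0 v) := by
    refine ⟨by fun_prop, ?_⟩
    rw [ProbabilityTheory.gaussianReal_map_const_mul]
    congr 1
    · simp
    · ext; simp [hv]
  have mp := measurePreserving_pi (fun _ : ι => ProbabilityTheory.gaussianReal 0 1)
    (fun _ : ι => ProbabilityTheory.gaussianReal 0 v) (fun _ => h1)
  rw [← mp.map_eq, integral_map mp.measurable.aemeasurable hf.aestronglyMeasurable]

lemma vv_abs (n : ℕ) (σ : Fin n → Bool) (e : Pr n) : |vv n σ e| = 1 := by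
  rcases vv_cases n σ e with h | h <;> simp [h]

lemma sk_reduction (n : ℕ) : ∫ J, (⨆ σ : Fin n → Bool, -HSK n J σ) ∂(skMeasure n) =
    (Real.sqrt n)⁻¹ *
      ∫ x, Mx (vv n) x ∂(Measure.pi fun _ : Pr n => ProbabilityTheory.gaussianReal 0 1) := by
  have hM : CLip 1 (Mx (vv n)) := Mx_lip (vv_abs n)
  have h1 : ∀ J : Fin n × Fin n → ℝ, (⨆ σ : Fin n → Bool, -HSK n J σ) =
      (Real.sqrt (2 * n))⁻¹ * (∑ i, J (i, i) + Mx (vv n) (fun e => J e.1 + J e.1.swap)) := by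
    intro J
    have : ∀ σ, -HSK n J σ = (Real.sqrt (2 * n))⁻¹ *
        (∑ i, J (i, i) + ∑ e : Pr n, (J e.1 + J e.1.swap) * vv n σ e) := by
      intro σ
      rw [HSK, neg_mul, neg_neg, sum_pairs]
      congr 2
      · refine Finset.sum_congr rfl fun i _ => ?_
        rw [mul_assoc, spin_sq, mul_one]
      · refine Finset.sum_congr rfl fun e _ => ?_
        simp only [vv, Prod.fst_swap, Prod.snd_swap]
        ring
    simp_rw [this]
    rw [← Real.mul_iSup_of_nonneg (by positivity)]
    congr 1
    rw [Mx, add_ciSup (Finite.bddAbove_range _)]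
  simp_rw [h1]
  have hMi := hM.integrable (memLp_gauss 2)
  have hd : ∀ i : Fin n, Integrable (fun J : Fin n × Fin n → ℝ => J (i, i)) (skMeasure n) ∧
      ∫ J, J (i, i) ∂(skMeasure n) = 0 := by
    intro i
    have mp := measurePreserving_eval (fun _ : Fin n × Fin n => ProbabilityTheory.gaussianReal 0 1) (i, i)
    constructor
    · exact mp.integrable_comp_of_integrable ((memLp_gauss 1).integrable (by norm_num))
    · have h2 : ∫ x, x ∂(ProbabilityTheory.gaussianReal 0 1) = 0 :=
        ProbabilityTheory.integral_id_gaussianReal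
      rw [← mp.map_eq, integral_map mp.measurable.aemeasurable
        (by fun_prop)] at h2
      exact h2
  have hmp := symm_mp n
  have hMc : Integrable (fun J : Fin n × Fin n → ℝ => Mx (vv n) (fun e => J e.1 + J e.1.swap))
      (skMeasure n) := hmp.integrable_comp_of_integrable hMi
  rw [integral_const_mul, integral_add (integrable_finsetSum _ fun i _ => (hd i).1) hMc,
    integral_finsetSum _ fun i _ => (hd i).1]
  simp_rw [(hd _).2]
  have e1 : ∫ J, Mx (vv n) (fun e => J e.1 + J e.1.swap) ∂(skMeasure n) =
      ∫ x, Mx (vv n) x ∂(Measure.pi fun _ : Pr n => ProbabilityTheory.gaussianReal 0 2) := by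
    rw [← hmp.map_eq, integral_map hmp.measurable.aemeasurable hM.continuous.aestronglyMeasurable]
  rw [e1, gauss_scale (s := Real.sqrt 2) (v := 2) (by simp) _ hM.continuous]
  simp_rw [Mx_smul (Real.sqrt_nonneg 2)]
  rw [integral_const_mul, Finset.sum_const_zero, zero_add, ← mul_assoc]
  congr 1
  rw [Real.sqrt_mul (by norm_num), mul_inv]
  have : Real.sqrt 2 ≠ 0 := by positivity
  field_simp


lemma fact_stirling (n : ℕ) (hn : 0 < n) : ∃ s : ℝ, (n.factorial : ℝ) =
    s * (Real.sqrt (2 * n) * (n / Real.exp 1) ^ n) ∧ Real.sqrt Real.pi ≤ s ∧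
    s ≤ Stirling.stirlingSeq 1 := by
  have hn' : (0 : ℝ) < n := by exact_mod_cast hn
  refine ⟨Stirling.stirlingSeq n, ?_, Stirling.sqrt_pi_le_stirlingSeq hn.ne', ?_⟩
  · rw [Stirling.stirlingSeq, div_mul_cancel₀]
    positivity
  · obtain ⟨k, rfl⟩ : ∃ k, n = k + 1 := ⟨n - 1, by omega⟩
    exact Stirling.stirlingSeq'_antitone (Nat.zero_le k)

lemma binom_lower : ∃ c : ℝ, 0 < c ∧ ∀ N m : ℕ, 0 < m → m < N →
    c / Real.sqrt m ≤ (N.choose m : ℝ) * (((m : ℝ) / N) ^ m * (1 - (m : ℝ) / N) ^ (N - m)) := by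
  set S := Stirling.stirlingSeq 1
  have hS : 0 < S := Stirling.stirlingSeq'_pos 0
  refine ⟨Real.sqrt Real.pi / (S ^ 2 * Real.sqrt 2), by positivity, ?_⟩
  intro N m hm hmN
  obtain ⟨k, rfl⟩ : ∃ k, N = m + k := ⟨N - m, by omega⟩
  have hk : 0 < k := by omega
  obtain ⟨s1, e1, l1, u1⟩ := fact_stirling m hm
  obtain ⟨s2, e2, l2, u2⟩ := fact_stirling k hk
  obtain ⟨s3, e3, l3, u3⟩ := fact_stirling (m + k) (by omega)
  have hch := Nat.choose_mul_factorial_mul_factorial (n := m + k) (k := m) (by omega)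
  rw [Nat.add_sub_cancel_left] at hch ⊢
  have hch' : ((m + k).choose m : ℝ) * m.factorial * k.factorial = (m + k).factorial := by
    exact_mod_cast hch
  rw [e1, e2, e3] at hch'
  have hm' : (0 : ℝ) < m := by exact_mod_cast hm
  have hk' : (0 : ℝ) < k := by exact_mod_cast hk
  have hpi : 0 < Real.sqrt Real.pi := Real.sqrt_pos.2 Real.pi_pos
  have hs1 : 0 < s1 := by linarith
  have hs2 : 0 < s2 := by linarith
  have hx : (1 : ℝ) - (m : ℝ) / ((m + k : ℕ) : ℝ) = k / ((m + k : ℕ) : ℝ) := by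
    push_cast; field_simp; ring
  rw [hx]
  set n' : ℝ := ((m + k : ℕ) : ℝ) with hn'
  have hnp : 0 < n' := by rw [hn']; push_cast; positivity
  set E := Real.exp 1
  have hE : 0 < E := Real.exp_pos 1
  set C : ℝ := ((m + k).choose m : ℝ)
  have key : C * ((m / n') ^ m * (k / n') ^ k) * (s1 * s2 * (Real.sqrt (2 * m) * Real.sqrt (2 * k)))
      = s3 * Real.sqrt (2 * n') := by
    have hpow : (n' / E) ^ (m + k) ≠ 0 := by positivity
    have e : ((m / n') ^ m * (k / n') ^ k) = ((m : ℝ) / E) ^ m * (k / E) ^ k / (n' / E) ^ (m + k) := by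
      rw [eq_div_iff hpow, pow_add]
      simp only [div_pow]
      field_simp
    rw [e]
    field_simp
    rw [← mul_assoc] at hch'
    simp only [div_pow] at hch' ⊢
    field_simp at hch' ⊢
    linarith
  have hq : 0 ≤ C * ((m / n') ^ m * (k / n') ^ k) := by positivity
  set Q := C * ((m / n') ^ m * (k / n') ^ k)
  rw [div_div, div_le_iff₀ (by positivity)]
  have h2k : Real.sqrt (2 * k) ≤ Real.sqrt (2 * n') := by
    apply Real.sqrt_le_sqrt
    rw [hn']; push_cast; linarith
  have h2kp : 0 < Real.sqrt (2 * k) := by positivity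
  have hs3 : 0 ≤ s3 := by linarith [Real.sqrt_nonneg Real.pi]
  have hss : s1 * s2 ≤ S ^ 2 := by rw [sq]; exact mul_le_mul u1 u2 hs2.le hS.le
  have hsm : Real.sqrt (2 * m) = Real.sqrt 2 * Real.sqrt m := Real.sqrt_mul (by norm_num) _
  have a1 : Real.sqrt Real.pi * Real.sqrt (2 * k) ≤ Q * (S ^ 2 * Real.sqrt (2 * m)) * Real.sqrt (2 * k) := by
    calc Real.sqrt Real.pi * Real.sqrt (2 * k) ≤ s3 * Real.sqrt (2 * n') := by gcongr
      _ = Q * (s1 * s2 * (Real.sqrt (2 * m) * Real.sqrt (2 * k))) := key.symm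
      _ ≤ Q * (S ^ 2 * (Real.sqrt (2 * m) * Real.sqrt (2 * k))) := by gcongr
      _ = _ := by ring
  have a2 := le_of_mul_le_mul_right a1 h2kp
  rw [hsm] at a2
  linarith

/-- Balanced spin configurations -/
abbrev Bal (n : ℕ) : Type := {σ : Fin n → Bool // IsBisection (univ.filter (fun i => σ i = true))}

noncomputable def vb (n : ℕ) (σ : Bal n) : Pr n → ℝ := vv n σ.1

noncomputable instance (n : ℕ) : Fintype (Bal n) := Fintype.ofFinite _

lemma card_Bal_ge (n : ℕ) : n.choose (n / 2) ≤ Fintype.card (Bal n) := by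
  have : Fintype.card (powersetCard (n / 2) (univ : Finset (Fin n))) =
      n.choose (n / 2) := by
    rw [Fintype.card_coe, card_powersetCard]; simp
  rw [← this]
  have PH : ∀ S : (powersetCard (n / 2) (univ : Finset (Fin n))),
      IsBisection (univ.filter (fun i => (decide (i ∈ S.1)) = true)) := by
    intro S
    have := (mem_powersetCard.1 S.2).2
    simp only [decide_eq_true_eq, filter_univ_mem, IsBisection, this]
    omega
  refine Fintype.card_le_of_injective
    (fun S : (powersetCard (n / 2) (univ : Finset (Fin n))) =>
      (⟨fun i => decide (i ∈ S.1), PH S⟩ : Bal n)) ?_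
  intro S T h
  simp only [Subtype.mk.injEq] at h
  ext i
  have := congrFun h i
  simpa using this

instance (n : ℕ) : Nonempty (Bal n) := by
  have := card_Bal_ge n
  have h2 : 0 < n.choose (n / 2) := Nat.choose_pos (by omega)
  exact Fintype.card_pos_iff.1 (by omega)

lemma bal_frac : ∃ c : ℝ, 0 < c ∧ ∀ n : ℕ, 2 ≤ n →
    c / Real.sqrt n * 2 ^ n ≤ Fintype.card (Bal n) := by
  obtain ⟨c, hc, h⟩ := binom_lower
  refine ⟨c / 2, by positivity, fun n hn => ?_⟩
  set k := n / 2
  have hk : 0 < k := by omega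
  have hkr : (0 : ℝ) < k := by exact_mod_cast hk
  have h1 := h (2 * k) k hk (by omega)
  have h2 : ((k : ℝ) / ((2 * k : ℕ) : ℝ)) = 1 / 2 := by push_cast; field_simp
  rw [h2, show 2 * k - k = k by omega] at h1
  norm_num at h1
  have h3 : ((2 * k).choose k : ℝ) ≤ Fintype.card (Bal n) := by
    have : (2 * k).choose k ≤ n.choose k := Nat.choose_le_choose _ (by omega)
    exact_mod_cast this.trans (card_Bal_ge n)
  have h4 : (2 : ℝ) ^ n ≤ 2 * (2 ^ k * 2 ^ k) := by
    rw [← pow_add, ← pow_succ']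
    exact pow_le_pow_right₀ (by norm_num) (by omega)
  have h5 : c / Real.sqrt n ≤ c / Real.sqrt k := by
    have : (k : ℝ) ≤ n := by exact_mod_cast (by omega : k ≤ n)
    gcongr
  calc c / 2 / Real.sqrt n * 2 ^ n = (c / Real.sqrt n) / 2 * 2 ^ n := by ring
    _ ≤ (c / Real.sqrt k) / 2 * (2 * (2 ^ k * 2 ^ k)) := by gcongr
    _ = (c / Real.sqrt k) * (2 ^ k * 2 ^ k) := by ring
    _ ≤ (((2 * k).choose k : ℝ) * ((1 / 2) ^ k * (1 / 2) ^ k)) * (2 ^ k * 2 ^ k) := by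
        gcongr
    _ = (2 * k).choose k := by
        rw [mul_assoc, ← mul_pow, ← mul_pow, ← mul_pow]; norm_num
    _ ≤ _ := h3

def gg {n : ℕ} (σ τ : Fin n → Bool) : Fin n → Bool := fun i => σ i == τ i

lemma gg_gg {n : ℕ} (σ τ : Fin n → Bool) : gg (gg σ τ) τ = σ := by
  ext i; simp only [gg]; cases σ i <;> cases τ i <;> rfl

lemma gg_gg' {n : ℕ} (σ τ : Fin n → Bool) : gg σ (gg σ τ) = τ := by
  ext i; simp only [gg]; cases σ i <;> cases τ i <;> rfl

lemma vv_gg {n : ℕ} (σ τ : Fin n → Bool) (e : Pr n) : vv n (gg σ τ) e = vv n τ e * vv n σ e := by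
  simp only [vv, gg]
  cases σ e.1.1 <;> cases τ e.1.1 <;> cases σ e.1.2 <;> cases τ e.1.2 <;> simp [spin]

lemma card_Pr_le (n : ℕ) : Fintype.card (Pr n) ≤ n ^ 2 := by
  have := Fintype.card_subtype_le (fun p : Fin n × Fin n => p.1 < p.2)
  simpa [sq] using this

lemma gauss_sq (v : NNReal) : ∫ x, x ^ 2 ∂(ProbabilityTheory.gaussianReal 0 v) = v := by
  have h := ProbabilityTheory.variance_id_gaussianReal (μ := 0) (v := v)
  rw [ProbabilityTheory.variance_of_integral_eq_zero (by fun_prop)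
    (by simp)] at h
  simpa using h

lemma vb_abs (n : ℕ) (σ : Bal n) (e : Pr n) : |vb n σ e| = 1 := vv_abs n _ e

lemma Mvb_le (n : ℕ) (x : Pr n → ℝ) : Mx (vb n) x ≤ Mx (vv n) x :=
  Mx_le fun k => le_Mx (v := vv n) x k.1

lemma gauge_bound (n : ℕ) :
    (Fintype.card (Bal n) : ℝ) *
    (∫ x, Mx (vv n) x ∂(Measure.pi fun _ : Pr n => ProbabilityTheory.gaussianReal 0 1) -
      ∫ x, Mx (vb n) x ∂(Measure.pi fun _ : Pr n => ProbabilityTheory.gaussianReal 0 1)) ^ 2 ≤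
    2 ^ n * (4 * (n : ℝ) ^ 2) := by
  set P := Measure.pi fun _ : Pr n => ProbabilityTheory.gaussianReal 0 1
  have lv : CLip 1 (Mx (vv n)) := Mx_lip (vv_abs n)
  have lb : CLip 1 (Mx (vb n)) := Mx_lip (vb_abs n)
  set D : (Pr n → ℝ) → ℝ := fun x => Mx (vv n) x - Mx (vb n) x with hD
  have lD : CLip 2 D := by
    intro x y
    have h1 := lv x y
    have h2 := lb x y
    rw [abs_le] at *
    constructor <;> simp only [hD] <;> linarith [h1.1, h1.2, h2.1, h2.2]
  rw [← integral_sub (lv.integrable (memLp_gauss 1)) (lb.integrable (memLp_gauss 1))]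
  change _ * (∫ x, D x ∂P) ^ 2 ≤ _
  set d := ∫ x, D x ∂P
  have hvar : ∫ x, (D x - d) ^ 2 ∂P ≤ 4 * (n : ℝ) ^ 2 := by
    have := var_pi (memLp_gauss 1) lD
    rw [gauss_sq] at this
    refine this.trans ?_
    have h : (Fintype.card (Pr n) : ℝ) ≤ (n : ℝ) ^ 2 := by exact_mod_cast card_Pr_le n
    norm_num
    linarith
  have hwi : Integrable (fun x => (D x - d) ^ 2) P :=
    ((lD.memLp (memLp_gauss 1)).sub (memLp_const d)).integrable_sq
  have hmp : ∀ τ : Fin n → Bool, MeasurePreserving (fun (x : Pr n → ℝ) e => vv n τ e * x e) P P := by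
    intro τ
    apply measurePreserving_pi (fun _ : Pr n => ProbabilityTheory.gaussianReal 0 1)
      (fun _ : Pr n => ProbabilityTheory.gaussianReal 0 1)
      (f := fun e t => vv n τ e * t)
    intro e
    refine ⟨by fun_prop, ?_⟩
    rw [ProbabilityTheory.gaussianReal_map_const_mul]
    congr 1
    · simp
    · ext
      rcases vv_cases n τ e with h | h <;> simp [h]
  have hinv : ∀ τ : Fin n → Bool, Integrable (fun x => (D (fun e => vv n τ e * x e) - d) ^ 2) P ∧
      ∫ x, (D (fun e => vv n τ e * x e) - d) ^ 2 ∂P = ∫ x, (D x - d) ^ 2 ∂P := by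
    intro τ
    refine ⟨(hmp τ).integrable_comp_of_integrable hwi, ?_⟩
    conv_rhs => rw [← (hmp τ).map_eq]
    rw [integral_map (hmp τ).measurable.aemeasurable]
    rw [(hmp τ).map_eq]
    exact hwi.aestronglyMeasurable
  have hsum : ∫ x, ∑ τ : Fin n → Bool, (D (fun e => vv n τ e * x e) - d) ^ 2 ∂P
      = 2 ^ n * ∫ x, (D x - d) ^ 2 ∂P := by
    rw [integral_finsetSum _ fun τ _ => (hinv τ).1]
    simp_rw [(hinv _).2]
    simp
  have hpt : ∀ x : Pr n → ℝ, (Fintype.card (Bal n) : ℝ) * d ^ 2 ≤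
      ∑ τ : Fin n → Bool, (D (fun e => vv n τ e * x e) - d) ^ 2 := by
    intro x
    obtain ⟨s, hs⟩ := exists_Mx (vv n) x
    have lin : ∀ σ τ : Fin n → Bool, ∑ e, (vv n τ e * x e) * vv n σ e
        = ∑ e, x e * vv n (gg σ τ) e := by
      intro σ τ
      refine Finset.sum_congr rfl fun e _ => ?_
      rw [vv_gg]; ring
    have h0 : ∀ b : Bal n, D (fun e => vv n (gg s b.1) e * x e) = 0 := by
      intro b
      set τ := gg s b.1
      have hb : gg s τ = b.1 := gg_gg' _ _
      apply le_antisymm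
      · simp only [hD, sub_nonpos]
        apply Mx_le
        intro σ
        rw [lin]
        refine (le_Mx x (gg σ τ)).trans ?_
        rw [hs]
        have := le_Mx (v := vb n) (fun e => vv n τ e * x e) b
        refine le_trans (le_of_eq ?_) this
        simp only [vb]
        rw [lin, ← hb, gg_gg]
      · simp only [hD, sub_nonneg]
        exact Mvb_le n _
    have hinj : Function.Injective (fun b : Bal n => gg s b.1) := by
      intro b b' h
      apply Subtype.ext
      have := congrArg (gg s) h
      simpa only [gg_gg'] using this
    classical
    calc (Fintype.card (Bal n) : ℝ) * d ^ 2
        = ∑ b : Bal n, (D (fun e => vv n (gg s b.1) e * x e) - d) ^ 2 := by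
          simp_rw [h0]; simp
      _ = ∑ τ ∈ univ.image (fun b : Bal n => gg s b.1), (D (fun e => vv n τ e * x e) - d) ^ 2 := by
          rw [Finset.sum_image (fun a _ b _ h => hinj h)]
      _ ≤ _ := Finset.sum_le_sum_of_subset_of_nonneg (Finset.subset_univ _)
          (fun _ _ _ => sq_nonneg _)
  have hfin := integral_mono (μ := P) (integrable_const _)
    (integrable_finsetSum _ fun τ _ => (hinv τ).1) hpt
  rw [hsum] at hfin
  simp only [integral_const, probReal_univ, smul_eq_mul, one_mul] at hfin
  refine hfin.trans ?_
  gcongr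


/-- law of p - X for X Bernoulli(p) -/
noncomputable def bern (p : ℝ) : Measure ℝ :=
  ENNReal.ofReal (1 - p) • Measure.dirac p + ENNReal.ofReal p • Measure.dirac (p - 1)

lemma bern_prob {p : ℝ} (h0 : 0 ≤ p) (h1 : p ≤ 1) : IsProbabilityMeasure (bern p) := by
  constructor
  simp only [bern, Measure.coe_add, Measure.coe_smul, Pi.add_apply, Pi.smul_apply, measure_univ,
    smul_eq_mul, mul_one]
  rw [← ENNReal.ofReal_add (by linarith) h0]
  simp

lemma bern_integrable (p : ℝ) (f : ℝ → ℝ) : Integrable f (bern p) := by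
  refine Integrable.add_measure ?_ ?_
  · exact (integrable_dirac (by simp)).smul_measure (by simp)
  · exact (integrable_dirac (by simp)).smul_measure (by simp)

lemma bern_integral {p : ℝ} (h0 : 0 ≤ p) (h1 : p ≤ 1) (f : ℝ → ℝ) :
    ∫ t, f t ∂(bern p) = (1 - p) * f p + p * f (p - 1) := by
  rw [bern, integral_add_measure]
  · rw [integral_smul_measure, integral_smul_measure, integral_dirac, integral_dirac]
    rw [ENNReal.toReal_ofReal (by linarith), ENNReal.toReal_ofReal h0]; rfl
  · exact (integrable_dirac (by simp)).smul_measure (by simp)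
  · exact (integrable_dirac (by simp)).smul_measure (by simp)

lemma bern_memLp (p : ℝ) : MemLp id 2 (bern p) := by
  rw [memLp_two_iff_integrable_sq (by fun_prop)]
  exact bern_integrable p _

lemma bern_mean {p : ℝ} (h0 : 0 ≤ p) (h1 : p ≤ 1) : ∫ t, t ∂(bern p) = 0 := by
  rw [bern_integral h0 h1 (fun t => t)]; ring

lemma bern_sq {p : ℝ} (h0 : 0 ≤ p) (h1 : p ≤ 1) : ∫ t, t ^ 2 ∂(bern p) = p * (1 - p) := by
  rw [bern_integral h0 h1 (fun t => t ^ 2)]; ring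

lemma bern_third {p : ℝ} (h0 : 0 ≤ p) (h1 : p ≤ 1) : ∫ t, |t| ^ 3 ∂(bern p) ≤ p := by
  rw [bern_integral h0 h1 (fun t => |t| ^ 3)]
  rw [abs_of_nonneg h0, abs_of_nonpos (by linarith)]
  have : (1 - p) * p ^ 3 + p * (-(p - 1)) ^ 3 = p * ((1 - p) * (p ^ 2 + (1 - p) ^ 2)) := by ring
  rw [this]
  have a : (1 - p) * (p ^ 2 + (1 - p) ^ 2) ≤ 1 := by
    nlinarith [mul_nonneg h0 (sub_nonneg.2 h1), mul_nonneg h0 h0, mul_nonneg (mul_nonneg h0 h0) (sub_nonneg.2 h1)]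
  nlinarith

/-- Gaussian third moment -/
noncomputable def K3 : ℝ := ∫ t, |t| ^ 3 ∂(ProbabilityTheory.gaussianReal 0 1)

lemma K3_nonneg : 0 ≤ K3 := integral_nonneg fun t => by positivity

lemma gauss_third (v : NNReal) (s : ℝ) (hs : 0 ≤ s) (hv : (v : ℝ) = s ^ 2) :
    Integrable (fun t : ℝ => |t| ^ 3) (ProbabilityTheory.gaussianReal 0 v) ∧
    ∫ t, |t| ^ 3 ∂(ProbabilityTheory.gaussianReal 0 v) = s ^ 3 * K3 := by
  constructor
  · have := (ProbabilityTheory.memLp_id_gaussianReal (μ := 0) (v := v) 3).integrable_norm_pow (by norm_num)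
    simpa using this
  · have : ProbabilityTheory.gaussianReal 0 v = (ProbabilityTheory.gaussianReal 0 1).map (s * ·) := by
      rw [ProbabilityTheory.gaussianReal_map_const_mul]
      congr 1
      · simp
      · ext; simp [hv]
    rw [this, integral_map (by fun_prop) (by fun_prop), K3, ← integral_const_mul]
    congr 1; ext t
    rw [abs_mul, abs_of_nonneg hs, mul_pow]

lemma card_Bal_le (n : ℕ) : Fintype.card (Bal n) ≤ 2 ^ n := by
  have := Fintype.card_le_of_injective (fun b : Bal n => b.1) Subtype.val_injective
  simpa using this

lemma vb_cases (n : ℕ) (σ : Bal n) (e : Pr n) : vb n σ e = 1 ∨ vb n σ e = -1 := vv_cases n _ e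

lemma compare (n : ℕ) {p β : ℝ} (h0 : 0 ≤ p) (h1 : p ≤ 1) (hβ : 0 < β) :
    |∫ x, Mx (vb n) x ∂(Measure.pi fun _ : Pr n => bern p) -
      Real.sqrt (p * (1 - p)) * ∫ x, Mx (vb n) x ∂(Measure.pi fun _ : Pr n => ProbabilityTheory.gaussianReal 0 1)|
    ≤ Fintype.card (Pr n) * p * β ^ 2 * (1 + K3) + β⁻¹ * n := by
  have hpp : 0 ≤ p * (1 - p) := mul_nonneg h0 (by linarith)
  set s := Real.sqrt (p * (1 - p)) with hs
  have hs0 : 0 ≤ s := Real.sqrt_nonneg _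
  have hs2 : s ^ 2 = p * (1 - p) := Real.sq_sqrt hpp
  let v : NNReal := ⟨p * (1 - p), hpp⟩
  have hv : (v : ℝ) = s ^ 2 := hs2.symm
  have hs1 : s ≤ 1 := by
    rw [hs]; exact Real.sqrt_le_iff.2 ⟨zero_le_one, by nlinarith⟩
  have hs3 : s ^ 3 ≤ p := by
    have : s ^ 3 = s * s ^ 2 := by ring
    rw [this, hs2]; nlinarith
  have := bern_prob h0 h1
  have g3 := gauss_third v s hs0 hv
  have L := lindeberg_Mx (v := vb n) (μ := bern p) (ν := ProbabilityTheory.gaussianReal 0 v) (vb_cases n)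
    (bern_memLp p) (memLp_gauss v) (bern_integrable p _) g3.1 (bern_mean h0 h1)
    (by simp) (by rw [bern_sq h0 h1, gauss_sq]; rfl) hβ
  rw [gauss_scale hv _ (Mx_lip (vb_abs n)).continuous] at L
  simp_rw [Mx_smul hs0] at L
  rw [integral_const_mul] at L
  refine L.trans (add_le_add ?_ ?_)
  · rw [g3.2]
    have b3 := bern_third h0 h1
    have k := K3_nonneg
    have : (∫ t, |t| ^ 3 ∂(bern p)) + s ^ 3 * K3 ≤ p * (1 + K3) := by nlinarith
    have pp : 0 ≤ p * (1 + K3) := by positivity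
    have hN : (0 : ℝ) ≤ Fintype.card (Pr n) := by positivity
    calc _ ≤ (Fintype.card (Pr n) : ℝ) * (β ^ 2 * (p * (1 + K3)) / 3) := by gcongr
      _ ≤ (Fintype.card (Pr n) : ℝ) * (β ^ 2 * (p * (1 + K3)) / 1) := by gcongr; norm_num
      _ = _ := by ring
  · have : Real.log (Fintype.card (Bal n)) ≤ n := by
      have c : (Fintype.card (Bal n) : ℝ) ≤ 2 ^ n := by exact_mod_cast card_Bal_le n
      have c0 : (0 : ℝ) < Fintype.card (Bal n) := by exact_mod_cast Fintype.card_pos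
      calc Real.log (Fintype.card (Bal n)) ≤ Real.log (2 ^ n) := Real.log_le_log c0 c
        _ = n * Real.log 2 := Real.log_pow _ _
        _ ≤ n * 1 := by gcongr; linarith [Real.log_two_lt_d9]
        _ = n := mul_one _
    gcongr


open Classical in
/-- edge indicator -/
noncomputable def XG {n : ℕ} (G : SimpleGraph (Fin n)) (e : Pr n) : ℝ :=
  if G.Adj e.1.1 e.1.2 then 1 else 0

lemma edges_eq {n : ℕ} (G : SimpleGraph (Fin n)) : (G.edgeSet.ncard : ℝ) = ∑ e, XG G e := by
  classical
  have h := G.sum_degrees_eq_twice_card_edges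
  have h1 : G.edgeSet.ncard = #G.edgeFinset := by
    rw [← SimpleGraph.coe_edgeFinset, Set.ncard_coe_finset]
  have h2 : ((∑ v, G.degree v : ℕ) : ℝ) = ∑ p : Fin n × Fin n, (if G.Adj p.1 p.2 then (1 : ℝ) else 0) := by
    rw [Fintype.sum_prod_type]
    push_cast
    refine Finset.sum_congr rfl fun i _ => ?_
    rw [← SimpleGraph.card_neighborFinset_eq_degree, SimpleGraph.neighborFinset_eq_filter]
    simp
  rw [sum_pairs] at h2
  have h3 : ∑ e : Pr n, ((if G.Adj e.1.1 e.1.2 then (1 : ℝ) else 0) +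
      if G.Adj e.1.swap.1 e.1.swap.2 then (1 : ℝ) else 0) = 2 * ∑ e, XG G e := by
    rw [Finset.mul_sum]
    refine Finset.sum_congr rfl fun e _ => ?_
    simp only [XG, Prod.fst_swap, Prod.snd_swap, G.adj_comm e.1.2 e.1.1]
    ring
  rw [h3] at h2
  rw [h] at h2
  simp only [SimpleGraph.irrefl, if_false, Finset.sum_const_zero, zero_add] at h2
  push_cast at h2
  rw [h1]; linarith

lemma cut_eq {n : ℕ} (G : SimpleGraph (Fin n)) (σ : Fin n → Bool) :
    2 * (cutSize G (univ.filter fun i => σ i = true) : ℝ) = ∑ e, XG G e * (1 - vv n σ e) := by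
  classical
  have h2 : (cutSize G (univ.filter fun i => σ i = true) : ℝ) =
      ∑ p : Fin n × Fin n, (if σ p.1 = true ∧ σ p.2 = false ∧ G.Adj p.1 p.2 then (1 : ℝ) else 0) := by
    rw [Fintype.sum_prod_type]
    simp only [cutSize]
    push_cast
    rw [Finset.sum_filter]
    refine Finset.sum_congr rfl fun i _ => ?_
    by_cases hi : σ i = true
    · simp only [hi, true_and, if_true]
      rw [Finset.compl_filter, Finset.sum_filter]
      refine Finset.sum_congr rfl fun j _ => ?_
      by_cases hj : σ j = true <;> simp [hj]
    · simp [hi]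
  rw [h2, sum_pairs]
  simp only [SimpleGraph.irrefl, and_false, if_false, Finset.sum_const_zero, zero_add]
  rw [Finset.mul_sum]
  refine Finset.sum_congr rfl fun e _ => ?_
  simp only [XG, vv, Prod.fst_swap, Prod.snd_swap, G.adj_comm e.1.2 e.1.1]
  by_cases h : G.Adj e.1.1 e.1.2
  · cases h1 : σ e.1.1 <;> cases h2 : σ e.1.2 <;> simp [h, spin] <;> norm_num
  · simp [h]

lemma bal_sum {n : ℕ} (b : Bal n) : |∑ e, vb n b e| ≤ n + 1 := by
  have h1 : (∑ i, spin (b.1 i)) ^ 2 = n + 2 * ∑ e, vb n b e := by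
    rw [sq, Finset.sum_mul_sum, ← Fintype.sum_prod_type', sum_pairs]
    rw [Finset.mul_sum]
    congr 1
    · simp [spin_sq]
    · refine Finset.sum_congr rfl fun e _ => ?_
      simp only [vb, vv, Prod.fst_swap, Prod.snd_swap]; ring
  have h2 : ∑ i, spin (b.1 i) = 2 * (#(univ.filter fun i => b.1 i = true) : ℝ) - n := by
    have : ∀ i, spin (b.1 i) = 2 * (if b.1 i = true then (1 : ℝ) else 0) - 1 := by
      intro i; cases b.1 i <;> simp [spin]; norm_num
    simp_rw [this]
    rw [Finset.sum_sub_distrib, ← Finset.mul_sum]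
    simp
  have hb := b.2
  unfold IsBisection at hb
  obtain ⟨u, w⟩ := hb
  have u' : (n : ℝ) - 1 ≤ 2 * (#(univ.filter fun i => b.1 i = true) : ℝ) := by exact_mod_cast u
  have w' : 2 * (#(univ.filter fun i => b.1 i = true) : ℝ) ≤ n + 1 := by exact_mod_cast w
  have h3 : (∑ i, spin (b.1 i)) ^ 2 ≤ 1 := by
    rw [h2, sq_le_one_iff_abs_le_one, abs_le]; constructor <;> linarith
  have h4 := sq_nonneg (∑ i, spin (b.1 i))
  have hn : (0 : ℝ) ≤ n := by positivity
  rw [abs_le]; constructor <;> linarith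

lemma mcut_bound {n : ℕ} (G : SimpleGraph (Fin n)) {p : ℝ} (hp : 0 ≤ p) :
    |2 * (MCUT G : ℝ) - G.edgeSet.ncard - Mx (vb n) (fun e => p - XG G e)| ≤ p * (n + 1) := by
  have key : ∀ b : Bal n, ∑ e, (p - XG G e) * vb n b e =
      p * ∑ e, vb n b e + (2 * (cutSize G (univ.filter fun i => b.1 i = true) : ℝ) - G.edgeSet.ncard) := by
    intro b
    rw [cut_eq, edges_eq, ← Finset.sum_sub_distrib, Finset.mul_sum, ← Finset.sum_add_distrib]
    refine Finset.sum_congr rfl fun e _ => ?_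
    simp only [vb]; ring
  have hbs : ∀ b : Bal n, |p * ∑ e, vb n b e| ≤ p * (n + 1) := by
    intro b
    rw [abs_mul, abs_of_nonneg hp]
    exact mul_le_mul_of_nonneg_left (bal_sum b) hp
  have hfin : Set.Finite {k : ℕ | ∃ S : Finset (Fin n), IsBisection S ∧ cutSize G S = k} := by
    refine (Set.finite_range (fun S : Finset (Fin n) => cutSize G S)).subset ?_
    rintro k ⟨S, _, rfl⟩
    exact ⟨S, rfl⟩
  have hle : ∀ b : Bal n, (cutSize G (univ.filter fun i => b.1 i = true) : ℝ) ≤ MCUT G := by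
    intro b
    exact_mod_cast le_csSup hfin.bddAbove ⟨_, b.2, rfl⟩
  obtain ⟨b0⟩ : Nonempty (Bal n) := inferInstance
  obtain ⟨S, hS, hc⟩ : MCUT G ∈ {k : ℕ | ∃ S : Finset (Fin n), IsBisection S ∧ cutSize G S = k} :=
    Nat.sSup_mem ⟨_, _, b0.2, rfl⟩ hfin.bddAbove
  have hfil : (univ.filter fun i => decide (i ∈ S) = true) = S := by ext i; simp
  let b1 : Bal n := ⟨fun i => decide (i ∈ S), by rw [hfil]; exact hS⟩
  have hb1 : (univ.filter fun i => b1.1 i = true) = S := hfil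
  have lo := le_Mx (v := vb n) (fun e => p - XG G e) b1
  rw [key b1, hb1, hc] at lo
  have hi : Mx (vb n) (fun e => p - XG G e) ≤ p * (n + 1) + (2 * (MCUT G : ℝ) - G.edgeSet.ncard) := by
    apply Mx_le
    intro b
    rw [key b]
    have := (abs_le.1 (hbs b)).2
    have := hle b
    linarith
  have := (abs_le.1 (hbs b1)).1
  rw [abs_le]; constructor <;> linarith


/-- graph from edge set -/
def grOf {n : ℕ} (T : Finset (Pr n)) : SimpleGraph (Fin n) where
  Adj i j := ∃ e ∈ T, e.1 = (i, j) ∨ e.1 = (j, i)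
  symm := by
    constructor
    rintro i j ⟨e, he, h⟩
    exact ⟨e, he, h.symm⟩
  loopless := by
    constructor
    rintro i ⟨e, he, h⟩
    have := e.2
    rcases h with h | h <;> rw [h] at this <;> exact lt_irrefl _ this

lemma grOf_adj {n : ℕ} (T : Finset (Pr n)) (e : Pr n) : (grOf T).Adj e.1.1 e.1.2 ↔ e ∈ T := by
  constructor
  · rintro ⟨f, hf, h | h⟩
    · have : f = e := Subtype.ext h
      rwa [← this]
    · have h1 := f.2
      have h2 := e.2
      rw [h] at h1
      exact absurd h1 (not_lt.2 h2.le)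
  · intro h
    exact ⟨e, h, Or.inl rfl⟩

lemma count_ge (n m : ℕ) : (Fintype.card (Pr n)).choose m ≤
    {G : SimpleGraph (Fin n) | G.edgeSet.ncard = m}.ncard := by
  classical
  have hinj : Function.Injective (grOf (n := n)) := by
    intro S T h
    ext e
    rw [← grOf_adj, ← grOf_adj, h]
  have h1 : ((grOf (n := n)) '' (powersetCard m (univ : Finset (Pr n)) : Set (Finset (Pr n)))).ncard
      = (Fintype.card (Pr n)).choose m := by
    rw [Set.ncard_image_of_injective _ hinj, Set.ncard_coe_finset, card_powersetCard]
    rfl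
  rw [← h1]
  refine Set.ncard_le_ncard ?_ (Set.toFinite _)
  rintro _ ⟨T, hT, rfl⟩
  have hT' : #T = m := (mem_powersetCard.1 hT).2
  have : ((grOf T).edgeSet.ncard : ℝ) = m := by
    rw [edges_eq]
    simp only [XG, grOf_adj]
    simp [hT']
  exact_mod_cast this

lemma XG_inj {n : ℕ} {G H : SimpleGraph (Fin n)} (h : XG G = XG H) : G = H := by
  have key : ∀ i j, i < j → (G.Adj i j ↔ H.Adj i j) := by
    intro i j hij
    have := congrFun h ⟨(i, j), hij⟩
    simp only [XG] at this
    by_cases a : G.Adj i j <;> by_cases b : H.Adj i j <;> simp_all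
  ext i j
  rcases lt_trichotomy i j with h | h | h
  · exact key i j h
  · subst h; simp
  · rw [G.adj_comm, H.adj_comm]; exact key j i h

lemma bern_sing {p : ℝ} (h0 : 0 ≤ p) (h1 : p ≤ 1) :
    1 - p ≤ (bern p).real {p} ∧ p ≤ (bern p).real {p - 1} := by
  have := bern_prob h0 h1
  constructor
  · simp [measureReal_def, bern, h1]
  · simp [measureReal_def, bern, h0]

lemma weight {n m : ℕ} {G : SimpleGraph (Fin n)} (hG : G.edgeSet.ncard = m) {p : ℝ} (h0 : 0 ≤ p) (h1 : p ≤ 1) :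
    p ^ m * (1 - p) ^ (Fintype.card (Pr n) - m) ≤
    (Measure.pi fun _ : Pr n => bern p).real {fun e => p - XG G e} := by
  classical
  have := bern_prob h0 h1
  have hm : #(univ.filter fun e : Pr n => G.Adj e.1.1 e.1.2) = m := by
    have := edges_eq G
    rw [hG] at this
    simp only [XG] at this
    simp only [Finset.sum_boole] at this
    exact_mod_cast this.symm
  have hm' : #(univ.filter fun e : Pr n => ¬ G.Adj e.1.1 e.1.2) = Fintype.card (Pr n) - m := by
    have := Finset.card_filter_add_card_filter_not (s := (univ : Finset (Pr n))) (fun e : Pr n => G.Adj e.1.1 e.1.2)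
    rw [hm, Finset.card_univ] at this
    omega
  rw [measureReal_def, Measure.pi_singleton, ENNReal.toReal_prod]
  calc p ^ m * (1 - p) ^ (Fintype.card (Pr n) - m)
      = ∏ e : Pr n, if G.Adj e.1.1 e.1.2 then p else 1 - p := by
        rw [Finset.prod_ite, Finset.prod_const, Finset.prod_const, hm, hm']
    _ ≤ _ := by
        apply Finset.prod_le_prod
        · intro e _; split_ifs <;> linarith
        · intro e _
          simp only [XG]
          split_ifs with h
          · exact (bern_sing h0 h1).2
          · simpa [measureReal_def] using (bern_sing h0 h1).1

lemma conc (n m : ℕ) {p t : ℝ} (h0 : 0 ≤ p) (h1 : p ≤ 1) (ht : 0 < t)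
    (hp : Fintype.card (Pr n) * p = m) :
    ({G : SimpleGraph (Fin n) | G.edgeSet.ncard = m ∧
      t < |Mx (vb n) (fun e => p - XG G e) - ∫ x, Mx (vb n) x ∂(Measure.pi fun _ : Pr n => bern p)|}.ncard : ℝ)
     * (p ^ m * (1 - p) ^ (Fintype.card (Pr n) - m)) * t ^ 2 ≤ m := by
  classical
  have := bern_prob h0 h1
  set μ := Measure.pi fun _ : Pr n => bern p
  set a := ∫ x, Mx (vb n) x ∂μ
  set w := p ^ m * (1 - p) ^ (Fintype.card (Pr n) - m)
  set B := {G : SimpleGraph (Fin n) | G.edgeSet.ncard = m ∧ t < |Mx (vb n) (fun e => p - XG G e) - a|}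
  have lb : CLip 1 (Mx (vb n)) := Mx_lip (vb_abs n)
  have hvar : ∫ x, (Mx (vb n) x - a) ^ 2 ∂μ ≤ m := by
    refine (var_pi (bern_memLp p) lb).trans ?_
    rw [bern_sq h0 h1, ← hp]
    have : (0 : ℝ) ≤ Fintype.card (Pr n) := by positivity
    have : p * (1 - p) ≤ p := by nlinarith
    rw [one_pow, one_mul]
    gcongr
  have hIntg : Integrable (fun x => (Mx (vb n) x - a) ^ 2) μ :=
    ((lb.memLp (bern_memLp p)).sub (memLp_const a)).integrable_sq
  have hBf : B.Finite := Set.toFinite _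
  set T := hBf.toFinset
  have hY : Function.Injective (fun (G : SimpleGraph (Fin n)) (e : Pr n) => p - XG G e) := by
    intro G H h
    apply XG_inj
    ext e
    have := congrFun h e
    simp only at this
    linarith
  set I := T.image (fun (G : SimpleGraph (Fin n)) (e : Pr n) => p - XG G e)
  have h2 : ∫ x in (I : Set (Pr n → ℝ)), (Mx (vb n) x - a) ^ 2 ∂μ ≤ ∫ x, (Mx (vb n) x - a) ^ 2 ∂μ :=
    setIntegral_le_integral hIntg (ae_of_all _ fun x => sq_nonneg _)
  rw [setIntegral_finset _ hIntg.integrableOn, Finset.sum_image (fun _ _ _ _ h => hY h)] at h2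
  have hw : 0 ≤ w := mul_nonneg (by positivity) (pow_nonneg (by linarith) _)
  have h3 : ∑ G ∈ T, w * t ^ 2 ≤ ∑ G ∈ T, μ.real {fun e => p - XG G e} •
      (Mx (vb n) (fun e => p - XG G e) - a) ^ 2 := by
    refine Finset.sum_le_sum fun G hG => ?_
    rw [Set.Finite.mem_toFinset] at hG
    obtain ⟨g1, g2⟩ := hG
    rw [smul_eq_mul]
    apply mul_le_mul (weight g1 h0 h1) _ (by positivity) measureReal_nonneg
    rw [← sq_abs (_ - a)]
    exact pow_le_pow_left₀ ht.le g2.le 2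
  rw [Finset.sum_const, nsmul_eq_mul] at h3
  rw [Set.ncard_eq_toFinset_card B hBf]
  linarith

lemma prob_ge : ∃ c : ℝ, 0 < c ∧ ∀ (n m : ℕ) (p t : ℝ) (B : Set (SimpleGraph (Fin n))),
    0 < m → m < Fintype.card (Pr n) → p = m / Fintype.card (Pr n) → 0 < t →
    (∀ G : SimpleGraph (Fin n), G.edgeSet.ncard = m →
      |Mx (vb n) (fun e => p - XG G e) - ∫ x, Mx (vb n) x ∂(Measure.pi fun _ : Pr n => bern p)| ≤ t →
      G ∈ B) →
    1 - m * Real.sqrt m / (c * t ^ 2) ≤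
      probUniform {G : SimpleGraph (Fin n) | G.edgeSet.ncard = m} B := by
  obtain ⟨c, hc, hb⟩ := binom_lower
  refine ⟨c, hc, fun n m p t B hm hmN hp ht hB => ?_⟩
  have hN : (0 : ℝ) < Fintype.card (Pr n) := by exact_mod_cast (by omega : 0 < Fintype.card (Pr n))
  have hmr : (0 : ℝ) < m := by exact_mod_cast hm
  have hmNr : (m : ℝ) < Fintype.card (Pr n) := by exact_mod_cast hmN
  have h0 : 0 < p := by rw [hp]; positivity
  have h1 : p < 1 := by rw [hp, div_lt_one hN]; exact hmNr
  have hc1 := conc n m h0.le h1.le ht (by rw [hp]; field_simp)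
  have hb1 := hb _ m hm hmN
  rw [← hp] at hb1
  set w := p ^ m * (1 - p) ^ (Fintype.card (Pr n) - m) with hw
  have hw0 : 0 < w := mul_pos (by positivity) (pow_pos (by linarith) _)
  set A := {G : SimpleGraph (Fin n) | G.edgeSet.ncard = m} with hA
  set D := {G : SimpleGraph (Fin n) | G.edgeSet.ncard = m ∧
      t < |Mx (vb n) (fun e => p - XG G e) - ∫ x, Mx (vb n) x ∂(Measure.pi fun _ : Pr n => bern p)|} with hD
  have hcA : ((Fintype.card (Pr n)).choose m : ℝ) ≤ A.ncard := by exact_mod_cast count_ge n m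
  have hAp : (0 : ℝ) < A.ncard := by
    refine lt_of_lt_of_le ?_ hcA
    exact_mod_cast Nat.choose_pos hmN.le
  have hsub : A ⊆ (A ∩ B) ∪ D := by
    intro G hG
    by_cases h : |Mx (vb n) (fun e => p - XG G e) -
        ∫ x, Mx (vb n) x ∂(Measure.pi fun _ : Pr n => bern p)| ≤ t
    · exact Or.inl ⟨hG, hB G hG h⟩
    · exact Or.inr ⟨hG, not_le.1 h⟩
  have hcard : (A.ncard : ℝ) ≤ (A ∩ B).ncard + D.ncard := by
    have := (Set.ncard_le_ncard hsub (Set.toFinite _)).trans (Set.ncard_union_le _ _)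
    exact_mod_cast this
  have hDA : (D.ncard : ℝ) ≤ m * Real.sqrt m / (c * t ^ 2) * A.ncard := by
    have hsm : 0 < Real.sqrt m := Real.sqrt_pos.2 hmr
    have q1 : c ≤ Real.sqrt m * (A.ncard * w) := by
      rw [div_le_iff₀ hsm] at hb1
      calc c ≤ _ := hb1
        _ ≤ (A.ncard * w) * Real.sqrt m := by gcongr
        _ = _ := by ring
    rw [div_mul_eq_mul_div, le_div_iff₀ (by positivity)]
    have q2 : (D.ncard : ℝ) * t ^ 2 * c ≤ (D.ncard : ℝ) * t ^ 2 * (Real.sqrt m * (A.ncard * w)) := by gcongr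
    have q3 : (D.ncard : ℝ) * w * t ^ 2 * (Real.sqrt m * A.ncard) ≤ m * (Real.sqrt m * A.ncard) := by gcongr
    linarith
  rw [probUniform, le_div_iff₀ hAp]
  linarith

lemma probUniform_le_one {α : Type*} [Finite α] (A B : Set α) : probUniform A B ≤ 1 := by
  rw [probUniform]
  apply div_le_one_of_le₀ _ (by positivity)
  exact_mod_cast Set.ncard_le_ncard Set.inter_subset_left (Set.toFinite _)


lemma card_Pr (n : ℕ) : (Fintype.card (Pr n) : ℝ) = n * (n - 1) / 2 := by
  have h := sum_pairs (n := n) (fun _ => (1 : ℝ))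
  simp at h
  linarith

noncomputable def mm (γ : ℝ) (n : ℕ) : ℕ := ⌊γ * n⌋₊
noncomputable def pp (γ : ℝ) (n : ℕ) : ℝ := mm γ n / Fintype.card (Pr n)
noncomputable def gN (n : ℕ) : ℝ :=
  ∫ x, Mx (vb n) x ∂(Measure.pi fun _ : Pr n => ProbabilityTheory.gaussianReal 0 1)
noncomputable def GN (n : ℕ) : ℝ :=
  ∫ x, Mx (vv n) x ∂(Measure.pi fun _ : Pr n => ProbabilityTheory.gaussianReal 0 1)

lemma lim_m {γ : ℝ} (hγ : 0 ≤ γ) : Tendsto (fun n : ℕ => (mm γ n : ℝ) / n) atTop (nhds γ) :=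
  (tendsto_nat_floor_mul_div_atTop hγ).comp tendsto_natCast_atTop_atTop

lemma lim_inv : Tendsto (fun n : ℕ => ((n : ℝ))⁻¹) atTop (nhds 0) := tendsto_inv_atTop_nhds_zero_nat

lemma lim_sqrt_inv : Tendsto (fun n : ℕ => (Real.sqrt n)⁻¹) atTop (nhds 0) :=
  (Real.tendsto_sqrt_atTop.comp tendsto_natCast_atTop_atTop).inv_tendsto_atTop

lemma lim_pn {γ : ℝ} (hγ : 0 ≤ γ) : Tendsto (fun n : ℕ => pp γ n * n) atTop (nhds (2 * γ)) := by
  have h := (lim_m hγ).mul ((tendsto_const_nhds (x := (2 : ℝ))).div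
    ((tendsto_const_nhds (x := (1 : ℝ))).sub lim_inv) (by norm_num))
  have e : γ * (2 / (1 - 0)) = 2 * γ := by ring
  rw [e] at h
  refine h.congr' ?_
  filter_upwards [eventually_ge_atTop 2] with n hn
  have : (2 : ℝ) ≤ n := by exact_mod_cast hn
  have h1 : (n : ℝ) - 1 ≠ 0 := by linarith
  have h0 : (n : ℝ) ≠ 0 := by linarith
  have h2 : 1 - (n : ℝ)⁻¹ ≠ 0 := by
    intro h
    apply h1
    field_simp at h
    linarith
  simp only [pp, card_Pr, Pi.div_apply]
  rw [show 1 - (n : ℝ)⁻¹ = (n - 1) / n by field_simp]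
  field_simp

lemma lim_p {γ : ℝ} (hγ : 0 ≤ γ) : Tendsto (fun n : ℕ => pp γ n) atTop (nhds 0) := by
  have h := (lim_pn hγ).mul lim_inv
  rw [mul_zero] at h
  refine h.congr' ?_
  filter_upwards [eventually_ge_atTop 1] with n hn
  have : (1 : ℝ) ≤ n := by exact_mod_cast hn
  field_simp

lemma lim_pe {γ : ℝ} (hγ : 0 ≤ γ) :
    Tendsto (fun n : ℕ => pp γ n * (n + 1) / n) atTop (nhds 0) := by
  have h := (lim_p hγ).mul ((tendsto_const_nhds (x := (1 : ℝ))).add lim_inv)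
  rw [zero_mul] at h
  refine h.congr' ?_
  filter_upwards [eventually_ge_atTop 1] with n hn
  have : (1 : ℝ) ≤ n := by exact_mod_cast hn
  field_simp

lemma lim_gap : Tendsto (fun n : ℕ => (GN n - gN n) / (n * Real.sqrt n)) atTop (nhds 0) := by
  obtain ⟨c, hc, hb⟩ := bal_frac
  have h2 : Tendsto (fun n : ℕ => ((GN n - gN n) / (n * Real.sqrt n)) ^ 2) atTop (nhds 0) := by
    have hz : Tendsto (fun n : ℕ => 4 / c * (Real.sqrt n)⁻¹) atTop (nhds 0) := by
      simpa using lim_sqrt_inv.const_mul (4 / c)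
    refine squeeze_zero' (Eventually.of_forall fun n => sq_nonneg _) ?_ hz
    filter_upwards [eventually_ge_atTop 2] with n hn
    have hnr : (2 : ℝ) ≤ n := by exact_mod_cast hn
    have hs : 0 < Real.sqrt n := Real.sqrt_pos.2 (by linarith)
    have hss : Real.sqrt n ^ 2 = n := Real.sq_sqrt (by linarith)
    have g := gauge_bound n
    change _ * (GN n - gN n) ^ 2 ≤ _ at g
    have b := hb n hn
    set d := (GN n - gN n) ^ 2 with hd
    have hd0 : 0 ≤ d := sq_nonneg _
    have q : c / Real.sqrt n * 2 ^ n * d ≤ 2 ^ n * (4 * (n : ℝ) ^ 2) :=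
      (mul_le_mul_of_nonneg_right b hd0).trans g
    have q2 : c / Real.sqrt n * d ≤ 4 * (n : ℝ) ^ 2 := by
      have : (0 : ℝ) < 2 ^ n := by positivity
      nlinarith
    have q3 : c * d ≤ 4 * (n : ℝ) ^ 2 * Real.sqrt n := by
      rw [div_mul_eq_mul_div, div_le_iff₀ hs] at q2
      exact q2
    rw [div_pow, ← hd, mul_pow, hss, div_le_iff₀ (by positivity)]
    have : 4 / c * (Real.sqrt n)⁻¹ * ((n : ℝ) ^ 2 * n) = 4 * (n : ℝ) ^ 2 * Real.sqrt n / c := by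
      rw [show (n : ℝ) ^ 2 * n = (n : ℝ) ^ 2 * (Real.sqrt n ^ 2) by rw [hss]]
      field_simp
    rw [this, le_div_iff₀ hc]
    linarith
  have h3 := h2.sqrt
  simp only [Real.sqrt_sq_eq_abs, Real.sqrt_zero] at h3
  exact (tendsto_zero_iff_abs_tendsto_zero _).2 h3

lemma lim_g {P : ℝ} (hP : Tendsto (fun n : ℕ =>
        (n : ℝ)⁻¹ * ∫ J, (⨆ σ : Fin n → Bool, -HSK n J σ) ∂(skMeasure n))
      atTop (nhds P)) : Tendsto (fun n : ℕ => gN n / (n * Real.sqrt n)) atTop (nhds P) := by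
  have h := hP.sub lim_gap
  rw [sub_zero] at h
  refine h.congr fun n => ?_
  rw [sk_reduction]
  change (n : ℝ)⁻¹ * ((Real.sqrt n)⁻¹ * GN n) - _ = _
  rw [sub_div, div_eq_mul_inv (GN n), mul_inv]
  ring

lemma lim_sg {P γ : ℝ} (hγ : 0 ≤ γ) (hP : Tendsto (fun n : ℕ =>
        (n : ℝ)⁻¹ * ∫ J, (⨆ σ : Fin n → Bool, -HSK n J σ) ∂(skMeasure n))
      atTop (nhds P)) :
    Tendsto (fun n : ℕ => Real.sqrt (pp γ n * (1 - pp γ n)) * gN n / n) atTop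
      (nhds (Real.sqrt (2 * γ) * P)) := by
  have h1 := ((lim_pn hγ).mul ((tendsto_const_nhds (x := (1 : ℝ))).sub (lim_p hγ))).sqrt
  have h := h1.mul (lim_g hP)
  rw [sub_zero, mul_one] at h
  refine h.congr' ?_
  filter_upwards [eventually_ge_atTop 1] with n hn
  have hnr : (1 : ℝ) ≤ n := by exact_mod_cast hn
  have hs : 0 < Real.sqrt n := Real.sqrt_pos.2 (by linarith)
  rw [show pp γ n * n * (1 - pp γ n) = (pp γ n * (1 - pp γ n)) * n by ring,
    Real.sqrt_mul' _ (by linarith)]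
  field_simp

lemma lim_prob {γ c δ : ℝ} (hγ : 0 ≤ γ) :
    Tendsto (fun n : ℕ => 1 - mm γ n * Real.sqrt (mm γ n) / (c * (δ * n) ^ 2)) atTop (nhds 1) := by
  have h := (((lim_m hγ).mul (lim_m hγ).sqrt).mul lim_sqrt_inv).const_mul ((c * δ ^ 2)⁻¹)
  have h2 := (tendsto_const_nhds (x := (1 : ℝ))).sub h
  rw [mul_zero, mul_zero, sub_zero] at h2
  refine h2.congr' ?_
  filter_upwards [eventually_ge_atTop 1] with n hn
  have hnr : (1 : ℝ) ≤ n := by exact_mod_cast hn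
  have hs : 0 < Real.sqrt n := Real.sqrt_pos.2 (by linarith)
  have hss : Real.sqrt n * Real.sqrt n = n := Real.mul_self_sqrt (by linarith)
  rw [Real.sqrt_div (by positivity)]
  congr 1
  rw [mul_inv, div_eq_mul_inv _ (c * _), mul_inv, mul_pow, mul_inv]
  have : (mm γ n : ℝ) / n * (Real.sqrt (mm γ n) / Real.sqrt n) * (Real.sqrt n)⁻¹
     = mm γ n * Real.sqrt (mm γ n) * ((n : ℝ) ^ 2)⁻¹ := by
    calc _ = (mm γ n : ℝ) / n * Real.sqrt (mm γ n) * (Real.sqrt n * Real.sqrt n)⁻¹ := by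
          rw [mul_inv]; ring
      _ = _ := by rw [hss]; field_simp
  rw [this]; ring


theorem max_bisection_ER
    (Pstar : ℝ)
    (hP : Tendsto (fun n : ℕ =>
        (n : ℝ)⁻¹ * ∫ J, (⨆ σ : Fin n → Bool, -HSK n J σ) ∂(skMeasure n))
      atTop (nhds Pstar)) :
    ∀ ε > (0 : ℝ), ∃ γ₀ : ℝ, ∀ γ ≥ γ₀,
      Tendsto (fun n : ℕ =>
          probUniform {G : SimpleGraph (Fin n) | G.edgeSet.ncard = ⌊γ * n⌋₊}
            {G : SimpleGraph (Fin n) |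
              |(MCUT G : ℝ) / n - (γ / 2 + Pstar * Real.sqrt (γ / 2))|
                ≤ ε * Real.sqrt γ})
        atTop (nhds 1) := by
  intro ε hε
  have hK := K3_nonneg
  refine ⟨max 1 ((64 * (1 + K3) / ε ^ 3) ^ 2), fun γ hγ => ?_⟩
  have hγ1 : 1 ≤ γ := (le_max_left _ _).trans hγ
  have hγ0 : 0 ≤ γ := by linarith
  set r := Real.sqrt γ with hr
  have hr0 : 0 < r := Real.sqrt_pos.2 (by linarith)
  have hr2 : r ^ 2 = γ := Real.sq_sqrt hγ0
  have hrK : 64 * (1 + K3) / ε ^ 3 ≤ r := Real.le_sqrt_of_sq_le ((le_max_right _ _).trans hγ)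
  obtain ⟨c, hc, hprob⟩ := prob_ge
  set δ := ε * r / 4 with hδ
  have hδ0 : 0 < δ := by positivity
  have hA : Tendsto (fun n : ℕ => |(mm γ n : ℝ) / n - γ| + pp γ n * (n + 1) / n +
      |Real.sqrt (pp γ n * (1 - pp γ n)) * gN n / n - Real.sqrt (2 * γ) * Pstar|) atTop (nhds 0) := by
    have h := ((((lim_m hγ0).sub_const γ).abs).add (lim_pe hγ0)).add
      (((lim_sg hγ0 hP).sub_const (Real.sqrt (2 * γ) * Pstar)).abs)
    simpa using h
  have hA' := hA.eventually_le_const (show 0 < ε * r by positivity)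
  have hp1 := (lim_p hγ0).eventually_lt_const (show (0 : ℝ) < 1 by norm_num)
  refine tendsto_of_tendsto_of_tendsto_of_le_of_le' (lim_prob (c := c) (δ := δ) hγ0)
    tendsto_const_nhds ?_ (Eventually.of_forall fun n => probUniform_le_one _ _)
  filter_upwards [hA', hp1, eventually_ge_atTop 2] with n hn1 hn2 hn3
  have hnr : (2 : ℝ) ≤ n := by exact_mod_cast hn3
  have hn0 : (0 : ℝ) < n := by linarith
  have hN : (0 : ℝ) < Fintype.card (Pr n) := by
    rw [card_Pr]
    have : (0 : ℝ) < n - 1 := by linarith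
    positivity
  have hm0 : 0 < mm γ n := by
    rw [mm, Nat.floor_pos]; nlinarith
  have hmN : mm γ n < Fintype.card (Pr n) := by
    rw [pp, div_lt_one hN] at hn2
    exact_mod_cast hn2
  have hp0 : 0 ≤ pp γ n := by rw [pp]; positivity
  refine hprob n (mm γ n) (pp γ n) (δ * n) _ hm0 hmN rfl (by positivity) fun G hG hG2 => ?_
  have hb := mcut_bound G hp0
  rw [hG] at hb
  have hcmp := compare n hp0 hn2.le (β := 4 / (ε * r)) (by positivity)
  change |_ - _ * gN n| ≤ _ at hcmp
  set a := ∫ x, Mx (vb n) x ∂(Measure.pi fun _ : Pr n => bern (pp γ n))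
  set F := Mx (vb n) (fun e => pp γ n - XG G e)
  set sg := Real.sqrt (pp γ n * (1 - pp γ n)) * gN n
  have hNp : (Fintype.card (Pr n) : ℝ) * pp γ n = mm γ n := by rw [pp]; field_simp
  have hml : (mm γ n : ℝ) ≤ γ * n := Nat.floor_le (by positivity)
  have herr : Fintype.card (Pr n) * pp γ n * (4 / (ε * r)) ^ 2 * (1 + K3) + (4 / (ε * r))⁻¹ * n ≤
      ε * r / 2 * n := by
    rw [hNp]
    have e1 : (mm γ n : ℝ) * (4 / (ε * r)) ^ 2 * (1 + K3) ≤ γ * n * (4 / (ε * r)) ^ 2 * (1 + K3) := by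
      gcongr
    have e2 : γ * n * (4 / (ε * r)) ^ 2 * (1 + K3) = ε * n / 4 * (64 * (1 + K3) / ε ^ 3) := by
      rw [← hr2]; field_simp; norm_num
    have e3 : ε * n / 4 * (64 * (1 + K3) / ε ^ 3) ≤ ε * n / 4 * r := by gcongr
    have e4 : (4 / (ε * r))⁻¹ * n = ε * n / 4 * r := by field_simp
    linarith
  have hcmp2 := hcmp.trans herr
  have hs2 : Real.sqrt (2 * γ) = 2 * Real.sqrt (γ / 2) := by
    rw [show 2 * γ = 2 ^ 2 * (γ / 2) by ring, Real.sqrt_mul (by norm_num), Real.sqrt_sq (by norm_num)]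
  rw [hs2] at hn1
  change |(MCUT G : ℝ) / n - (γ / 2 + Pstar * Real.sqrt (γ / 2))| ≤ ε * r
  set M := (MCUT G : ℝ)
  have id1 : 2 * (M / n - (γ / 2 + Pstar * Real.sqrt (γ / 2))) =
      ((mm γ n : ℝ) / n - γ) + (2 * M - mm γ n - F) / n + (F - a) / n + (a - sg) / n
        + (sg / n - 2 * Real.sqrt (γ / 2) * Pstar) := by
    field_simp; ring
  have dv : ∀ x y : ℝ, |x| ≤ y → |x / n| ≤ y / n := by
    intro x y h
    rw [abs_div, abs_of_pos hn0]; gcongr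
  have d1 := dv _ _ hb
  have d2 := dv _ _ hG2
  have d3 := dv _ _ hcmp2
  rw [mul_div_assoc, div_self hn0.ne', mul_one] at d2 d3
  have tot : |2 * (M / n - (γ / 2 + Pstar * Real.sqrt (γ / 2)))| ≤ 2 * (ε * r) := by
    rw [id1]
    refine (abs_add_le _ _).trans ?_
    have t1 := abs_add_le (((mm γ n : ℝ) / n - γ) + (2 * M - mm γ n - F) / n + (F - a) / n) ((a - sg) / n)
    have t2 := abs_add_le (((mm γ n : ℝ) / n - γ) + (2 * M - mm γ n - F) / n) ((F - a) / n)
    have t3 := abs_add_le ((mm γ n : ℝ) / n - γ) ((2 * M - mm γ n - F) / n)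
    linarith
  rw [abs_mul, abs_two] at tot
  linarith
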